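/- arXiv:1005.3430 — 6 statements merged into one kernel-verified Lean document; each statement's English description precedes it below -/
import Mathlib

section
/- Let κ > 0 and μ ∈ ℝ. Then (1 + e^{-μ})^{-κ} = ∫_0^∞ ∫_0^∞ (2πλ)^{-1/2} · exp( −(z − μ − (1/2)(1−κ)λ)² / (2λ) ) · q_{1,κ}(λ) dλ dz, where the outer integral is over z ∈ (0,∞) and the inner over λ ∈ (0,∞). (This is the paper's Theorem 1, the hierarchical cdf representation of the powered-up logistic likelihood, with μ playing the role of y·xᵀβ.) -/
/-- The Euler Beta function `B(a,b) = Γ(a)Γ(b)/Γ(a+b)`. -/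
noncomputable def betaFn (a b : ℝ) : ℝ := Real.Gamma a * Real.Gamma b / Real.Gamma (a + b)

/-- The weights `w_k` of the Polya density: with `δ = (a+b)/2`,
`w_k = (-1)^k (2δ)(2δ+1)⋯(2δ+k-1)/k! · (δ+k)/B(a,b)`. -/
noncomputable def polyaWeight (a b : ℝ) (k : ℕ) : ℝ :=
  (-1 : ℝ) ^ k * (∏ i ∈ Finset.range k, (a + b + i)) / (Nat.factorial k) *
    ((a + b) / 2 + k) / betaFn a b

/-- The Polya density `q_{a,b}(λ) = Σ_{k=0}^∞ w_k exp(-ψ_k λ/2)` with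
`ψ_k = (a+k)(b+k)`. -/
noncomputable def polya (a b lam : ℝ) : ℝ :=
  ∑' k : ℕ, polyaWeight a b k * Real.exp (-((a + k) * (b + k) * lam / 2))

open MeasureTheory Filter Topology

theorem prod_range_add_eq_ascPochhammer_eval (a : ℝ) (k : ℕ) :
    ∏ i ∈ Finset.range k, (a + i) = (ascPochhammer ℝ k).eval a := by
  induction k with
  | zero => simp
  | succ n ih => rw [Finset.prod_range_succ, ascPochhammer_succ_eval, ih]

/-- The generating function of the coefficients `(a)_k / k!`. -/
theorem hasSum_prod_div_factorial_mul_pow (a : ℝ) {r : ℝ} (hr : |r| < 1) :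
    HasSum (fun k : ℕ => (∏ i ∈ Finset.range k, (a + i)) / (Nat.factorial k) * r ^ k)
      ((1 - r) ^ (-a)) := by
  have h := (Real.one_div_one_sub_rpow_hasFPowerSeriesOnBall_zero a).hasSum (y := r)
    (by simpa [Metric.mem_eball, edist_zero_right, enorm, ← NNReal.coe_lt_coe] using hr)
  have h1 : 0 ≤ 1 - r := by linarith [(abs_lt.mp hr).2]
  rw [zero_add, one_div, ← Real.rpow_neg h1] at h
  refine (congrArg (HasSum · _) (funext fun k => ?_)).mpr h
  have hchoose := Ring.factorial_nsmul_multichoose_eq_ascPochhammer a k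
  rw [Polynomial.ascPochhammer_smeval_eq_eval, nsmul_eq_mul,
    ← prod_range_add_eq_ascPochhammer_eval] at hchoose
  rw [← hchoose, FormalMultilinearSeries.ofScalars_apply_eq, ← Ring.multichoose_eq,
    mul_div_cancel_left₀ _ (Nat.cast_ne_zero.mpr (Nat.factorial_ne_zero k)), smul_eq_mul]

theorem tendsto_integral_exp_neg_sq_div_two_atTop :
    Tendsto (fun y : ℝ => ∫ t in (0 : ℝ)..y, Real.exp (-t ^ 2 / 2)) atTop
      (𝓝 (√(2 * Real.pi) / 2)) := by
  have h := intervalIntegral_tendsto_integral_Ioi (0 : ℝ)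
    (integrable_exp_neg_mul_sq (b := 1 / 2) (by norm_num)).integrableOn tendsto_id
  rw [integral_gaussian_Ioi] at h
  convert h using 2
  · congr 1 with t
    simp; ring
  · congr 2; ring

theorem tendsto_integral_exp_neg_sq_div_two_atBot :
    Tendsto (fun y : ℝ => ∫ t in (0 : ℝ)..y, Real.exp (-t ^ 2 / 2)) atBot
      (𝓝 (-(√(2 * Real.pi) / 2))) := by
  have h := (tendsto_integral_exp_neg_sq_div_two_atTop.comp tendsto_neg_atBot_atTop).neg
  refine h.congr fun y => ?_
  have := intervalIntegral.integral_comp_neg (a := 0) (b := y)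
    (fun t : ℝ => Real.exp (-t ^ 2 / 2))
  simp only [neg_sq, neg_zero] at this
  rw [Function.comp_apply, this, ← intervalIntegral.integral_symm]

theorem hasDerivAt_integral_exp_neg_sq_div_two (y : ℝ) :
    HasDerivAt (fun y : ℝ => ∫ t in (0 : ℝ)..y, Real.exp (-t ^ 2 / 2))
      (Real.exp (-y ^ 2 / 2)) y := by
  have hc : Continuous fun t : ℝ => Real.exp (-t ^ 2 / 2) := by fun_prop
  exact intervalIntegral.integral_hasDerivAt_right (hc.intervalIntegrable _ _)
    (hc.stronglyMeasurableAtFilter _ _) hc.continuousAt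

/-- The Laplace transform of the hitting-time kernel `λ^{-1/2} e^{-x²/(2λ)}`. -/
theorem integral_inv_sqrt_mul_exp_of_pos {x s : ℝ} (hx : 0 < x) (hs : 0 < s) :
    IntegrableOn (fun l : ℝ => s * ((√l)⁻¹ * Real.exp (-x ^ 2 / (2 * l) - s ^ 2 * l / 2)))
        (Set.Ioi 0) ∧
      ∫ l in Set.Ioi (0 : ℝ), s * ((√l)⁻¹ * Real.exp (-x ^ 2 / (2 * l) - s ^ 2 * l / 2)) =
        √(2 * Real.pi) * Real.exp (-(x * s)) := by
  set E : ℝ → ℝ := fun y => ∫ t in (0 : ℝ)..y, Real.exp (-t ^ 2 / 2) with hE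
  set L : ℝ := √(2 * Real.pi) / 2 with hL
  set F : ℝ → ℝ := fun l => Real.exp (-(x * s)) * E (s * √l - x * (√l)⁻¹) +
    Real.exp (x * s) * E (s * √l + x * (√l)⁻¹) with hF
  have hsqrt_zero : Tendsto (fun l : ℝ => √l) (𝓝[>] 0) (𝓝[>] 0) := by
    refine tendsto_nhdsWithin_iff.mpr ⟨?_, ?_⟩
    · have := (Real.continuous_sqrt.tendsto 0).mono_left (nhdsWithin_le_nhds (s := Set.Ioi 0))
      simpa using this
    · filter_upwards [self_mem_nhdsWithin] with l hl
      exact Real.sqrt_pos.mpr hl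
  have hinv_zero : Tendsto (fun l : ℝ => x * (√l)⁻¹) (𝓝[>] 0) atTop :=
    (tendsto_inv_nhdsGT_zero.comp hsqrt_zero).const_mul_atTop hx
  have hmul_zero : Tendsto (fun l : ℝ => s * √l) (𝓝[>] 0) (𝓝 0) := by
    simpa using (hsqrt_zero.mono_right nhdsWithin_le_nhds).const_mul s
  have hinv_top : Tendsto (fun l : ℝ => x * (√l)⁻¹) atTop (𝓝 0) := by
    simpa using (tendsto_inv_atTop_zero.comp Real.tendsto_sqrt_atTop).const_mul x
  have hmul_top : Tendsto (fun l : ℝ => s * √l) atTop atTop :=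
    Real.tendsto_sqrt_atTop.const_mul_atTop hs
  have hF_top : Tendsto F atTop (𝓝 (Real.exp (-(x * s)) * L + Real.exp (x * s) * L)) := by
    refine ((tendsto_integral_exp_neg_sq_div_two_atTop.comp ?_).const_mul _).add
      ((tendsto_integral_exp_neg_sq_div_two_atTop.comp ?_).const_mul _)
    · simpa only [sub_eq_add_neg] using hmul_top.atTop_add hinv_top.neg
    · exact hmul_top.atTop_add hinv_top
  have hF_zero : Tendsto F (𝓝[>] 0) (𝓝 (Real.exp (-(x * s)) * -L + Real.exp (x * s) * L)) := by
    refine ((tendsto_integral_exp_neg_sq_div_two_atBot.comp ?_).const_mul _).add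
      ((tendsto_integral_exp_neg_sq_div_two_atTop.comp ?_).const_mul _)
    · simpa only [sub_eq_add_neg, Function.comp_def] using
        hmul_zero.add_atBot (tendsto_neg_atTop_atBot.comp hinv_zero)
    · exact hmul_zero.add_atTop hinv_zero
  have hderiv : ∀ l ∈ Set.Ioi (0 : ℝ), HasDerivAt F
      (s * ((√l)⁻¹ * Real.exp (-x ^ 2 / (2 * l) - s ^ 2 * l / 2))) l := by
    intro l hl
    have hl : 0 < l := hl
    have hsq : 0 < √l := Real.sqrt_pos.mpr hl
    have h1 := (Real.hasDerivAt_sqrt hl.ne').const_mul s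
    have h2 := ((Real.hasDerivAt_sqrt hl.ne').fun_inv hsq.ne').const_mul x
    have h := (((hasDerivAt_integral_exp_neg_sq_div_two _).comp l (h1.sub h2)).const_mul
      (Real.exp (-(x * s)))).add
      (((hasDerivAt_integral_exp_neg_sq_div_two _).comp l (h1.add h2)).const_mul
      (Real.exp (x * s)))
    refine h.congr_deriv ?_
    have e1 : Real.exp (-(x * s)) * Real.exp (-(s * √l - x * (√l)⁻¹) ^ 2 / 2) =
        Real.exp (-x ^ 2 / (2 * l) - s ^ 2 * l / 2) := by
      rw [← Real.exp_add]
      congr 1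
      nth_rw 4 [← Real.sq_sqrt hl.le]
      nth_rw 3 [← Real.sq_sqrt hl.le]
      field_simp
      ring
    have e2 : Real.exp (x * s) * Real.exp (-(s * √l + x * (√l)⁻¹) ^ 2 / 2) =
        Real.exp (-x ^ 2 / (2 * l) - s ^ 2 * l / 2) := by
      rw [← Real.exp_add]
      congr 1
      nth_rw 4 [← Real.sq_sqrt hl.le]
      nth_rw 3 [← Real.sq_sqrt hl.le]
      field_simp
      ring
    simp only [Pi.sub_apply, Pi.add_apply]
    rw [← mul_assoc, ← mul_assoc, e1, e2]
    field_simp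
    ring
  have hderiv' : ∀ l ∈ Set.Ioi (0 : ℝ), HasDerivAt
      (Function.update F 0 (Real.exp (-(x * s)) * -L + Real.exp (x * s) * L))
      (s * ((√l)⁻¹ * Real.exp (-x ^ 2 / (2 * l) - s ^ 2 * l / 2))) l := by
    intro l hl
    refine (hderiv l hl).congr_of_eventuallyEq ?_
    filter_upwards [eventually_ne_nhds (ne_of_gt hl)] with y hy
    exact Function.update_of_ne hy _ _
  have hcont : ContinuousWithinAt
      (Function.update F 0 (Real.exp (-(x * s)) * -L + Real.exp (x * s) * L)) (Set.Ici 0) 0 := by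
    rw [continuousWithinAt_update_same]
    simpa using hF_zero
  have htop : Tendsto (Function.update F 0 (Real.exp (-(x * s)) * -L + Real.exp (x * s) * L))
      atTop (𝓝 (Real.exp (-(x * s)) * L + Real.exp (x * s) * L)) := by
    refine hF_top.congr' ?_
    filter_upwards [eventually_ne_atTop 0] with y hy
    exact (Function.update_of_ne hy _ _).symm
  have hpos : ∀ l ∈ Set.Ioi (0 : ℝ),
      0 ≤ s * ((√l)⁻¹ * Real.exp (-x ^ 2 / (2 * l) - s ^ 2 * l / 2)) := fun l _ => by positivity
  refine ⟨integrableOn_Ioi_deriv_of_nonneg hcont hderiv' hpos htop, ?_⟩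
  rw [integral_Ioi_of_hasDerivAt_of_nonneg hcont hderiv' hpos htop, Function.update_self, hL]
  ring

theorem integrableOn_inv_sqrt_mul_exp {x s : ℝ} (hx : x ≠ 0) (hs : 0 < s) :
    IntegrableOn (fun l : ℝ => (√l)⁻¹ * Real.exp (-x ^ 2 / (2 * l) - s ^ 2 * l / 2))
      (Set.Ioi 0) := by
  have h := (integral_inv_sqrt_mul_exp_of_pos (abs_pos.mpr hx) hs).1.const_mul s⁻¹
  simp only [inv_mul_cancel_left₀ hs.ne', sq_abs] at h
  exact h

theorem integral_inv_sqrt_mul_exp {x s : ℝ} (hx : x ≠ 0) (hs : 0 < s) :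
    ∫ l in Set.Ioi (0 : ℝ), (√l)⁻¹ * Real.exp (-x ^ 2 / (2 * l) - s ^ 2 * l / 2) =
      √(2 * Real.pi) * Real.exp (-(|x| * s)) / s := by
  have h := (integral_inv_sqrt_mul_exp_of_pos (abs_pos.mpr hx) hs).2
  rw [integral_const_mul, sq_abs] at h
  rw [eq_div_iff hs.ne', mul_comm, h]

theorem polyaWeight_one (κ : ℝ) (hκ : 0 < κ) (k : ℕ) :
    polyaWeight 1 κ k = κ * ((1 + κ) / 2 + k) *
      ((-1) ^ k * ((∏ i ∈ Finset.range k, (1 + κ + i)) / (Nat.factorial k))) := by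
  have hg : Real.Gamma κ ≠ 0 := (Real.Gamma_pos_of_pos hκ).ne'
  rw [polyaWeight, betaFn, Real.Gamma_one, add_comm 1 κ, Real.Gamma_add_one hκ.ne']
  field_simp

/-- The normal variance-mean mixture with Polya mixing density is a generalised logistic law. -/
theorem integral_gaussian_mul_polya (κ x : ℝ) (hκ : 0 < κ) (hx : x ≠ 0) :
    ∫ lam in Set.Ioi (0 : ℝ), (2 * Real.pi * lam) ^ (-(1 : ℝ) / 2) *
        Real.exp (-(x - (1 / 2) * (1 - κ) * lam) ^ 2 / (2 * lam)) * polya 1 κ lam =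
      κ * Real.exp x * (1 + Real.exp x) ^ (-κ - 1) := by
  set δ : ℝ := (1 + κ) / 2 with hδ
  have hδ0 : 0 < δ := by positivity
  have hs : ∀ k : ℕ, 0 < δ + k := fun k => by positivity
  set C : ℝ := Real.exp ((1 - κ) / 2 * x) * (√(2 * Real.pi))⁻¹ with hC
  set p : ℕ → ℝ := fun k => (∏ i ∈ Finset.range k, (1 + κ + i)) / (Nat.factorial k) with hp
  have hp0 : ∀ k, 0 ≤ p k := fun k =>
    div_nonneg (Finset.prod_nonneg fun i _ => by positivity) (by positivity)
  have hw : ∀ k, polyaWeight 1 κ k = κ * (δ + k) * ((-1) ^ k * p k) := polyaWeight_one κ hκ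
  set f : ℕ → ℝ → ℝ := fun k l => C * polyaWeight 1 κ k *
    ((√l)⁻¹ * Real.exp (-x ^ 2 / (2 * l) - (δ + k) ^ 2 * l / 2)) with hf
  have hterm : ∀ l ∈ Set.Ioi (0 : ℝ), (2 * Real.pi * l) ^ (-(1 : ℝ) / 2) *
      Real.exp (-(x - (1 / 2) * (1 - κ) * l) ^ 2 / (2 * l)) * polya 1 κ l = ∑' k, f k l := by
    intro l hl
    have hl : 0 < l := hl
    rw [polya, ← tsum_mul_left]
    refine tsum_congr fun k => ?_
    have e1 : (2 * Real.pi * l) ^ (-(1 : ℝ) / 2) = (√(2 * Real.pi))⁻¹ * (√l)⁻¹ := by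
      rw [neg_div, Real.rpow_neg (by positivity), ← Real.sqrt_eq_rpow,
        Real.sqrt_mul (by positivity), mul_inv]
    have e2 : Real.exp (-(x - (1 / 2) * (1 - κ) * l) ^ 2 / (2 * l)) *
        Real.exp (-((1 + k) * (κ + k) * l / 2)) = Real.exp ((1 - κ) / 2 * x) *
          Real.exp (-x ^ 2 / (2 * l) - (δ + k) ^ 2 * l / 2) := by
      rw [← Real.exp_add, ← Real.exp_add]
      congr 1
      rw [hδ]
      field_simp
      ring
    calc _ = (2 * Real.pi * l) ^ (-(1 : ℝ) / 2) * polyaWeight 1 κ k *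
          (Real.exp (-(x - (1 / 2) * (1 - κ) * l) ^ 2 / (2 * l)) *
          Real.exp (-((1 + k) * (κ + k) * l / 2))) := by ring
      _ = f k l := by rw [e1, e2, hf, hC]; ring
  have hr0 : 0 < Real.exp (-|x|) := Real.exp_pos _
  have hr1 : Real.exp (-|x|) < 1 := Real.exp_lt_one_iff.mpr (neg_lt_zero.mpr (abs_pos.mpr hx))
  have hexp : ∀ k : ℕ, Real.exp (-(|x| * (δ + k))) =
      Real.exp (-(|x| * δ)) * Real.exp (-|x|) ^ k := fun k => by
    rw [← Real.exp_nat_mul, ← Real.exp_add]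
    congr 1
    ring
  have hkernel : ∀ k : ℕ, ∫ l in Set.Ioi (0 : ℝ),
      (√l)⁻¹ * Real.exp (-x ^ 2 / (2 * l) - (δ + k) ^ 2 * l / 2) =
        √(2 * Real.pi) * (Real.exp (-(|x| * δ)) * Real.exp (-|x|) ^ k) / (δ + k) := fun k => by
    rw [integral_inv_sqrt_mul_exp hx (hs k), hexp]
  have h2π : √(2 * Real.pi) ≠ 0 := by positivity
  set A : ℝ := κ * Real.exp ((1 - κ) / 2 * x) * Real.exp (-(|x| * δ)) with hA
  have h_integral : ∀ k, ∫ l in Set.Ioi (0 : ℝ), f k l = A * (p k * (-Real.exp (-|x|)) ^ k) := by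
    intro k
    have := (hs k).ne'
    rw [hf, integral_const_mul, hkernel, hw, hC, hA, neg_pow (Real.exp _)]
    field_simp
  have hnorm : ∀ k, ∫ l in Set.Ioi (0 : ℝ), ‖f k l‖ = A * (p k * Real.exp (-|x|) ^ k) := fun k => by
    have hk := (hs k).ne'
    have e : ∀ l, ‖f k l‖ = C * (κ * (δ + k) * p k) *
        ((√l)⁻¹ * Real.exp (-x ^ 2 / (2 * l) - (δ + k) ^ 2 * l / 2)) := fun l => by
      simp only [hf, hw]
      have h1 : 0 ≤ κ * (δ + k) := mul_nonneg hκ.le (hs k).le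
      have h2 : 0 ≤ C := by positivity
      have h3 : 0 ≤ (√l)⁻¹ * Real.exp (-x ^ 2 / (2 * l) - (δ + k) ^ 2 * l / 2) := by positivity
      rw [norm_mul, Real.norm_of_nonneg h3, norm_mul C, Real.norm_of_nonneg h2, norm_mul (κ * _),
        Real.norm_of_nonneg h1, norm_mul _ (p k), Real.norm_of_nonneg (hp0 k), norm_pow, norm_neg,
        norm_one, one_pow, one_mul]
    simp_rw [e]
    rw [integral_const_mul, hkernel, hC, hA]
    field_simp
  have hsum := hasSum_integral_of_summable_integral_norm (μ := volume.restrict (Set.Ioi (0 : ℝ)))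
    (F := f) (fun k => (integrableOn_inv_sqrt_mul_exp hx (hs k)).const_mul _) (by
      simp_rw [hnorm]
      exact ((hasSum_prod_div_factorial_mul_pow (1 + κ)
        (by rwa [abs_of_pos hr0])).summable).mul_left A)
  simp_rw [h_integral] at hsum
  have hval := (hasSum_prod_div_factorial_mul_pow (1 + κ) (r := -Real.exp (-|x|))
    (by rwa [abs_neg, abs_of_pos hr0])).mul_left A
  rw [setIntegral_congr_fun measurableSet_Ioi hterm, hsum.unique hval, hA, sub_neg_eq_add]
  have hexponent : -(1 + κ) = -κ - 1 := by ring
  rcases hx.lt_or_gt with hneg | hpos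
  · rw [abs_of_neg hneg, neg_neg, hexponent, mul_assoc κ, ← Real.exp_add]
    congr 3
    rw [hδ]
    ring
  · have hfac : 1 + Real.exp x = Real.exp x * (1 + Real.exp (-x)) := by
      rw [mul_add, ← Real.exp_add]
      simp [add_comm]
    rw [abs_of_pos hpos, hfac, Real.mul_rpow (Real.exp_pos _).le (by positivity), ← Real.exp_mul,
      hexponent, mul_assoc κ, ← Real.exp_add, ← mul_assoc, mul_assoc κ (Real.exp x),
      ← Real.exp_add]
    congr 3
    rw [hδ]
    ring

theorem integral_logistic_power_density (κ μ : ℝ) (hκ : 0 < κ) :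
    ∫ z in Set.Ioi (0 : ℝ), κ * Real.exp (z - μ) * (1 + Real.exp (z - μ)) ^ (-κ - 1) =
      (1 + Real.exp (-μ)) ^ (-κ) := by
  have hderiv : ∀ z ∈ Set.Ici (0 : ℝ), HasDerivAt (fun z => -(1 + Real.exp (z - μ)) ^ (-κ))
      (κ * Real.exp (z - μ) * (1 + Real.exp (z - μ)) ^ (-κ - 1)) z := fun z _ => by
    have h := ((((hasDerivAt_id z).sub_const μ).exp.const_add 1).rpow_const (p := -κ)
      (Or.inl (by simp only [id]; positivity))).neg
    refine h.congr_deriv ?_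
    simp only [id]
    ring
  have htop : Tendsto (fun z => -(1 + Real.exp (z - μ)) ^ (-κ)) atTop (𝓝 0) := by
    have h : Tendsto (fun z : ℝ => 1 + Real.exp (z - μ)) atTop atTop :=
      tendsto_atTop_add_const_left _ _
        (Real.tendsto_exp_atTop.comp (tendsto_atTop_add_const_right _ (-μ) tendsto_id))
    simpa using ((tendsto_rpow_neg_atTop hκ).comp h).neg
  rw [integral_Ioi_of_hasDerivAt_of_nonneg' hderiv (fun z _ => by positivity) htop]
  simp

/-- **Theorem 1 (cdf representation).** For `κ > 0` and `μ ∈ ℝ`,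
`(1 + e^{-μ})^{-κ} = ∫_0^∞ ∫_0^∞ (2πλ)^{-1/2} exp(-(z - μ - (1/2)(1-κ)λ)²/(2λ)) q_{1,κ}(λ) dλ dz`. -/
theorem logistic_power_cdf_representation (κ μ : ℝ) (hκ : 0 < κ) :
    (1 + Real.exp (-μ)) ^ (-κ) =
      ∫ z in Set.Ioi (0 : ℝ), ∫ lam in Set.Ioi (0 : ℝ),
        (2 * Real.pi * lam) ^ (-(1 : ℝ) / 2) *
          Real.exp (-(z - μ - (1 / 2) * (1 - κ) * lam) ^ 2 / (2 * lam)) *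
          polya 1 κ lam := by
  rw [← integral_logistic_power_density κ μ hκ]
  refine setIntegral_congr_ae measurableSet_Ioi ?_
  filter_upwards [compl_mem_ae_iff.mpr (measure_singleton (μ := volume) μ)] with z hz _
  exact (integral_gaussian_mul_polya κ (z - μ) hκ (sub_ne_zero.mpr hz)).symm
end

section
/- Let a, b > 0, σ > 0, μ ∈ ℝ, and z ∈ ℝ. Then the z-distribution density admits the normal variance–mean scale-mixture representation (1/(σ B(a,b))) · e^{a(z−μ)/σ} / (1 + e^{(z−μ)/σ})^{a+b} = ∫_0^∞ (2πλσ²)^{-1/2} · exp( −(z − μ − (1/2)(a−b)λσ)² / (2λσ²) ) · q_{a,b}(λ) dλ. -/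
section

open Real MeasureTheory Filter Topology Set

/-- The coefficients `(-1)^k (p)_k / k!` of the power series of `(1 + w)^(-p)`. -/
noncomputable def negBinomCoeff (p : ℝ) (k : ℕ) : ℝ :=
  (-1 : ℝ) ^ k * (∏ i ∈ Finset.range k, (p + i)) / (Nat.factorial k)

lemma negBinomCoeff_succ (p : ℝ) (k : ℕ) :
    (k + 1) * negBinomCoeff p (k + 1) = -(p + k) * negBinomCoeff p k := by
  have h1 : ((k.factorial : ℕ) : ℝ) ≠ 0 := by positivity
  have h2 : (k : ℝ) + 1 ≠ 0 := by positivity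
  simp only [negBinomCoeff, Finset.prod_range_succ, Nat.factorial_succ, pow_succ]
  push_cast
  field_simp

lemma negBinomCoeff_zero (p : ℝ) : negBinomCoeff p 0 = 1 := by simp [negBinomCoeff]

lemma choose_neg_eq_negBinomCoeff (p : ℝ) (k : ℕ) :
    Ring.choose (-p) k = negBinomCoeff p k := by
  have h1 : ((k.factorial : ℕ) : ℝ) ≠ 0 := by positivity
  rw [Ring.choose_neg, ← Ring.multichoose_eq, negBinomCoeff, eq_div_iff h1, Units.smul_def,
    zsmul_eq_mul, mul_assoc, mul_comm _ (k.factorial : ℝ), ← nsmul_eq_mul (k.factorial),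
    Ring.factorial_nsmul_multichoose_eq_ascPochhammer]
  congr 1
  · simp
  · rw [Polynomial.ascPochhammer_smeval_eq_eval]
    induction k with
    | zero => simp
    | succ n ih =>
      rw [ascPochhammer_succ_eval, Finset.prod_range_succ, ih (by positivity)]

lemma hasSum_negBinomCoeff_mul_pow (p : ℝ) {w : ℂ} (hw : ‖w‖ < 1) :
    HasSum (fun k => (negBinomCoeff p k : ℂ) * w ^ k) ((1 + w) ^ (-(p : ℂ))) := by
  have h := (Complex.one_add_cpow_hasFPowerSeriesOnBall_zero (a := -(p : ℂ))).hasSum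
    (y := w) (by simpa [← ofReal_norm] using hw)
  simp only [binomialSeries_apply, zero_add] at h
  refine h.congr_fun fun k => ?_
  rw [← choose_neg_eq_negBinomCoeff, Complex.ofReal_choose]
  simp

lemma hasSum_negBinomCoeff_mul_pow_real (p : ℝ) {r : ℝ} (h0 : 0 ≤ r) (h1 : r < 1) :
    HasSum (fun k => negBinomCoeff p k * r ^ k) ((1 + r) ^ (-p)) := by
  have h := hasSum_negBinomCoeff_mul_pow p (w := r) (by simpa [abs_of_nonneg h0] using h1)
  rw [← Complex.ofReal_one, ← Complex.ofReal_add, ← Complex.ofReal_neg,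
    ← Complex.ofReal_cpow (by positivity)] at h
  exact_mod_cast h

lemma mul_negBinomCoeff_add_one (p : ℝ) (k : ℕ) :
    p * negBinomCoeff (p + 1) k = (p + k) * negBinomCoeff p k := by
  induction k with
  | zero => simp [negBinomCoeff_zero]
  | succ k ih =>
    have h2 : (k : ℝ) + 1 ≠ 0 := by positivity
    apply mul_left_cancel₀ h2
    have e1 := negBinomCoeff_succ p k
    have e2 := negBinomCoeff_succ (p + 1) k
    push_cast
    linear_combination p * e2 - (p + k + 1) * e1 - (p + 1 + k) * ih

lemma negBinomCoeff_succ_mul (p : ℝ) (k : ℕ) :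
    negBinomCoeff p (k + 1) * (p / 2 + (k + 1 : ℕ)) =
      p / 2 * (negBinomCoeff (p + 1) (k + 1) - negBinomCoeff (p + 1) k) := by
  have e1 := negBinomCoeff_succ p k
  have e2 := mul_negBinomCoeff_add_one p k
  have e3 := mul_negBinomCoeff_add_one p (k + 1)
  push_cast at *
  linear_combination e1 / 2 + e2 / 2 - e3 / 2

lemma hasSum_negBinomCoeff_mul_mul_pow (p : ℝ) {w : ℂ} (hw : ‖w‖ < 1) :
    HasSum (fun k : ℕ => ((negBinomCoeff p k * (p / 2 + k) : ℝ) : ℂ) * w ^ k)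
      (p / 2 * ((1 - w) * (1 + w) ^ (-((p + 1 : ℝ) : ℂ)))) := by
  have h := hasSum_negBinomCoeff_mul_pow (p + 1) hw
  have h' := (hasSum_nat_add_iff' 1).mpr h
  rw [← hasSum_nat_add_iff' 1]
  have hval : (p / 2 * ((1 - w) * (1 + w) ^ (-((p + 1 : ℝ) : ℂ))) : ℂ) -
      ∑ k ∈ Finset.range 1, ((negBinomCoeff p k * (p / 2 + k) : ℝ) : ℂ) * w ^ k =
      p / 2 * ((1 + w) ^ (-((p + 1 : ℝ) : ℂ)) -
        ∑ k ∈ Finset.range 1, (negBinomCoeff (p + 1) k : ℂ) * w ^ k -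
          w * (1 + w) ^ (-((p + 1 : ℝ) : ℂ))) := by
    simp only [Finset.sum_range_one, negBinomCoeff_zero]
    push_cast
    ring
  rw [hval]
  refine ((h'.sub (h.mul_left w)).mul_left ((p : ℂ) / 2)).congr_fun fun k => ?_
  rw [negBinomCoeff_succ_mul]
  push_cast
  ring

lemma summable_abs_negBinomCoeff_mul_pow (p : ℝ) {r : ℝ} (h0 : 0 ≤ r) (h1 : r < 1) :
    Summable (fun k : ℕ => |negBinomCoeff p k * (p / 2 + k)| * r ^ k) := by
  have h := (hasSum_negBinomCoeff_mul_mul_pow p (w := r)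
    (by simpa [abs_of_nonneg h0] using h1)).summable.norm
  refine h.congr fun k => ?_
  rw [norm_mul, Complex.norm_real, norm_pow, Complex.norm_real, Real.norm_eq_abs,
    Real.norm_eq_abs, abs_of_nonneg h0]

lemma exp_neg_sq_eq_integral (m s : ℝ) :
    ∫ r : ℝ, Complex.exp (-(m * s) * (1 + Complex.I * r)) *
      Complex.exp (-(r - Complex.I) ^ 2 / 2) =
      ((√(2 * π) * rexp (-(m ^ 2 * s ^ 2 / 2)) : ℝ) : ℂ) := by
  have h := integral_cexp_quadratic (b := -(1 / 2 : ℂ)) (by norm_num)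
    (Complex.I * (1 - m * s)) (1 / 2 - m * s)
  convert h using 1
  · congr 1
    ext r
    rw [← Complex.exp_add]
    congr 1
    linear_combination (-1 / 2 : ℂ) * Complex.I_sq
  · push_cast
    congr 1
    · rw [Real.sqrt_eq_rpow, Complex.ofReal_cpow (by positivity)]
      push_cast
      congr 1
      field_simp
    · congr 1
      linear_combination (-1 / 2 : ℂ) * (1 - m * s) ^ 2 * Complex.I_sq

lemma inv_norm_one_add_exp_le {s : ℝ} (hs : 0 < s) (r : ℝ) :
    ‖1 + Complex.exp (-s * (1 + Complex.I * r))‖⁻¹ ≤ 1 + |r| := by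
  have hr := abs_nonneg r
  rcases le_or_gt (s * |r|) 1 with h | h
  · have h1 : 1 ≤ ‖1 + Complex.exp (-s * (1 + Complex.I * r))‖ := by
      refine le_trans ?_ (Complex.re_le_norm _)
      have : 0 ≤ cos (-(s * r)) := by
        apply cos_nonneg_of_mem_Icc
        have h2 : |s * r| ≤ 1 := by rwa [abs_mul, abs_of_pos hs]
        have := abs_le.mp h2
        have := pi_gt_three
        constructor <;> linarith
      rw [cos_neg] at this
      suffices 0 ≤ rexp (-s) * cos (s * r) by simpa [Complex.exp_re] using this
      positivity
    exact (inv_le_one_of_one_le₀ h1).trans (by linarith)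
  · have h1 : s / (1 + s) ≤ ‖1 + Complex.exp (-s * (1 + Complex.I * r))‖ := by
      have h2 := norm_sub_le (1 + Complex.exp (-s * (1 + Complex.I * r)))
        (Complex.exp (-s * (1 + Complex.I * r)))
      have h3 : ‖Complex.exp (-s * (1 + Complex.I * r))‖ = rexp (-s) := by
        simp [Complex.norm_exp]
      rw [add_sub_cancel_right, norm_one, h3, Real.exp_neg] at h2
      have h4 : (rexp s)⁻¹ ≤ (1 + s)⁻¹ := by
        gcongr
        linarith [add_one_le_exp s]
      have h5 : s / (1 + s) = 1 - (1 + s)⁻¹ := by field_simp; ring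
      linarith
    calc _ ≤ (s / (1 + s))⁻¹ := by gcongr
      _ = 1 + 1 / s := by field_simp; ring
      _ ≤ _ := by
        gcongr
        rw [div_le_iff₀ hs]
        linarith

lemma norm_negBinom_kernel_le {p s : ℝ} (hp : 0 < p) (hs : 0 < s) (r : ℝ) {w : ℂ}
    (hw : w = Complex.exp (-s * (1 + Complex.I * r))) :
    ‖(p / 2 * ((1 - w) * (1 + w) ^ (-((p + 1 : ℝ) : ℂ))) : ℂ)‖ ≤ p * (1 + |r|) ^ (p + 1) := by
  have h1 : ‖1 - w‖ ≤ 2 := by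
    have : ‖w‖ ≤ 1 := by
      rw [hw, Complex.norm_exp]
      simp [hs.le]
    calc _ ≤ ‖(1 : ℂ)‖ + ‖w‖ := norm_sub_le _ _
      _ ≤ 2 := by rw [norm_one]; linarith
  have h2 : ‖(1 + w) ^ (-((p + 1 : ℝ) : ℂ))‖ ≤ (1 + |r|) ^ (p + 1) := by
    rw [← Complex.ofReal_neg, Complex.norm_cpow_real, Real.rpow_neg (norm_nonneg _),
      ← Real.inv_rpow (norm_nonneg _)]
    gcongr
    rw [hw]
    exact inv_norm_one_add_exp_le hs r
  have h3 : ‖(p / 2 : ℂ)‖ = p / 2 := by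
    simp [abs_of_pos hp]
  rw [norm_mul, norm_mul, h3]
  calc _ ≤ p / 2 * (2 * (1 + |r|) ^ (p + 1)) := by gcongr
    _ = _ := by ring

lemma one_add_abs_rpow_mul_exp_le {q : ℝ} (hq : 0 ≤ q) (r : ℝ) :
    (1 + |r|) ^ q * rexp (-(1 / 2) * r ^ 2) ≤ rexp (q ^ 2) * rexp (-(1 / 4) * r ^ 2) := by
  calc (1 + |r|) ^ q * rexp (-(1 / 2) * r ^ 2)
      ≤ (rexp |r|) ^ q * rexp (-(1 / 2) * r ^ 2) := by
        gcongr
        linarith [add_one_le_exp |r|]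
    _ = rexp (|r| * q + -(1 / 2) * r ^ 2) := by rw [← Real.exp_mul, Real.exp_add]
    _ ≤ rexp (q ^ 2 + -(1 / 4) * r ^ 2) := by
        apply Real.exp_le_exp.mpr
        nlinarith [sq_nonneg (q - |r| / 2), sq_abs r]
    _ = _ := Real.exp_add _ _

/-- The theta-like series `∑ (-1)^k (p)_k / k! (p/2 + k) exp(-(p/2 + k)² l / 2)`. -/
noncomputable def thetaKernel (p l : ℝ) : ℝ :=
  ∑' k : ℕ, negBinomCoeff p k * (p / 2 + k) * rexp (-((p / 2 + k) ^ 2 * l / 2))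

lemma norm_shifted_gaussian (r : ℝ) :
    ‖Complex.exp (-(r - Complex.I) ^ 2 / 2)‖ = rexp (1 / 2) * rexp (-(1 / 2) * r ^ 2) := by
  rw [Complex.norm_exp, ← Real.exp_add]
  congr 1
  simp [pow_two]
  ring

lemma summable_and_abs_thetaKernel_le {p : ℝ} (hp : 0 < p) :
    ∃ C : ℝ, ∀ s : ℝ, 0 < s →
      Summable (fun k : ℕ =>
        negBinomCoeff p k * (p / 2 + k) * rexp (-((p / 2 + k) ^ 2 * s ^ 2 / 2))) ∧
      |thetaKernel p (s ^ 2)| ≤ C * rexp (-(p / 2 * s)) := by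
  refine ⟨(√(2 * π))⁻¹ * ∫ r : ℝ, (p * rexp (1 / 2) * rexp ((p + 1) ^ 2)) *
    rexp (-(1 / 4) * r ^ 2), fun s hs => ?_⟩
  set F : ℕ → ℝ → ℂ := fun k r => ((negBinomCoeff p k * (p / 2 + k) : ℝ) : ℂ) *
    (Complex.exp (-((p / 2 + k : ℝ) * s) * (1 + Complex.I * r)) *
      Complex.exp (-(r - Complex.I) ^ 2 / 2)) with hF
  have hnorm : ∀ k r, ‖F k r‖ = (|negBinomCoeff p k * (p / 2 + k)| * rexp (-s) ^ k) *
      (rexp (-(p / 2 * s)) * rexp (1 / 2)) * rexp (-(1 / 2) * r ^ 2) := by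
    intro k r
    rw [hF]
    simp only [norm_mul, norm_shifted_gaussian, Complex.norm_real, Real.norm_eq_abs, abs_mul]
    have : ‖Complex.exp (-((p / 2 + k : ℝ) * s) * (1 + Complex.I * r))‖ =
        rexp (-s) ^ k * rexp (-(p / 2 * s)) := by
      rw [Complex.norm_exp, ← Real.exp_nat_mul, ← Real.exp_add]
      congr 1
      simp
      ring
    rw [this]
    ring
  have hF_int : ∀ k, Integrable (F k) := by
    intro k
    have hc : Continuous (F k) := by
      simp only [hF]
      fun_prop
    refine Integrable.mono' ((integrable_exp_neg_mul_sq (b := 1 / 2) (by norm_num)).const_mul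
      ((|negBinomCoeff p k * (p / 2 + k)| * rexp (-s) ^ k) *
      (rexp (-(p / 2 * s)) * rexp (1 / 2)))) hc.aestronglyMeasurable ?_
    exact Eventually.of_forall fun r => (hnorm k r).le
  have hs1 : rexp (-s) < 1 := by simpa using hs
  have hsum : Summable fun k => ∫ r, ‖F k r‖ := by
    simp only [hnorm, integral_const_mul]
    exact ((summable_abs_negBinomCoeff_mul_pow p (exp_pos _).le hs1).mul_right _).mul_right _
  have hmain := hasSum_integral_of_summable_integral_norm hF_int hsum
  have hterm : ∀ k, ∫ r, F k r = ((√(2 * π) * (negBinomCoeff p k * (p / 2 + k) *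
      rexp (-((p / 2 + k) ^ 2 * s ^ 2 / 2))) : ℝ) : ℂ) := by
    intro k
    simp only [hF]
    rw [integral_const_mul, exp_neg_sq_eq_integral]
    push_cast
    ring
  simp only [hterm] at hmain
  have hsqrt_pos : √(2 * π) ≠ 0 := by positivity
  have hsummable : Summable (fun k : ℕ =>
      negBinomCoeff p k * (p / 2 + k) * rexp (-((p / 2 + k) ^ 2 * s ^ 2 / 2))) :=
    (summable_mul_left_iff hsqrt_pos).mp (Complex.summable_ofReal.mp hmain.summable)
  refine ⟨hsummable, ?_⟩
  have heq : ((√(2 * π) * thetaKernel p (s ^ 2) : ℝ) : ℂ) = ∫ r, ∑' k, F k r := by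
    rw [← hmain.tsum_eq, ← Complex.ofReal_tsum, tsum_mul_left, thetaKernel]
  have hbound : ∀ r : ℝ, ‖∑' k, F k r‖ ≤ rexp (-(p / 2 * s)) *
      ((p * rexp (1 / 2) * rexp ((p + 1) ^ 2)) * rexp (-(1 / 4) * r ^ 2)) := by
    intro r
    set w : ℂ := Complex.exp (-s * (1 + Complex.I * r)) with hw
    have hw1 : ‖w‖ < 1 := by
      rw [hw, Complex.norm_exp]
      simpa using hs
    have hs2 := ((hasSum_negBinomCoeff_mul_mul_pow p hw1).mul_right
      (Complex.exp (-((p / 2 : ℝ) * s) * (1 + Complex.I * r)) *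
        Complex.exp (-(r - Complex.I) ^ 2 / 2)))
    have hFk : (fun k => F k r) = fun k : ℕ =>
        ((negBinomCoeff p k * (p / 2 + k) : ℝ) : ℂ) * w ^ k *
        (Complex.exp (-((p / 2 : ℝ) * s) * (1 + Complex.I * r)) *
        Complex.exp (-(r - Complex.I) ^ 2 / 2)) := by
      ext k
      have : Complex.exp (-((p / 2 + k : ℝ) * s) * (1 + Complex.I * r)) =
          w ^ k * Complex.exp (-((p / 2 : ℝ) * s) * (1 + Complex.I * r)) := by
        rw [hw, ← Complex.exp_nat_mul, ← Complex.exp_add]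
        congr 1
        push_cast
        ring
      simp only [hF, this]
      ring
    rw [hFk, hs2.tsum_eq, norm_mul, norm_mul (Complex.exp _), norm_shifted_gaussian]
    have h1 : ‖Complex.exp (-((p / 2 : ℝ) * s) * (1 + Complex.I * r))‖ =
        rexp (-(p / 2 * s)) := by
      rw [Complex.norm_exp]
      congr 1
      simp
    rw [h1]
    calc _ ≤ (p * (1 + |r|) ^ (p + 1)) *
          (rexp (-(p / 2 * s)) * (rexp (1 / 2) * rexp (-(1 / 2) * r ^ 2))) := by
          gcongr
          exact norm_negBinom_kernel_le hp hs r hw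
      _ = (p * rexp (-(p / 2 * s)) * rexp (1 / 2)) *
          ((1 + |r|) ^ (p + 1) * rexp (-(1 / 2) * r ^ 2)) := by ring
      _ ≤ (p * rexp (-(p / 2 * s)) * rexp (1 / 2)) *
          (rexp ((p + 1) ^ 2) * rexp (-(1 / 4) * r ^ 2)) := by
          gcongr ?_ * ?_
          exact one_add_abs_rpow_mul_exp_le (by linarith) r
      _ = _ := by ring
  have hfin := norm_integral_le_of_norm_le (((integrable_exp_neg_mul_sq (b := 1 / 4)
    (by norm_num)).const_mul _).const_mul _) (Eventually.of_forall hbound)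
  rw [← heq, integral_const_mul, Complex.norm_real, Real.norm_eq_abs, abs_mul,
    abs_of_pos (by positivity : 0 < √(2 * π))] at hfin
  rw [mul_assoc, inv_mul_eq_div, le_div_iff₀ (by positivity)]
  linarith

lemma hasDerivAt_gaussian_primitive (u : ℝ) :
    HasDerivAt (fun u => ∫ v in (0 : ℝ)..u, rexp (-(1 / 2) * v ^ 2)) (rexp (-(1 / 2) * u ^ 2)) u :=
  intervalIntegral.integral_hasDerivAt_right
    (Continuous.intervalIntegrable (by fun_prop) _ _)
    (Continuous.stronglyMeasurableAtFilter (by fun_prop) _ _)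
    (Continuous.continuousAt (by fun_prop))

lemma tendsto_gaussian_primitive_atTop :
    Tendsto (fun u => ∫ v in (0 : ℝ)..u, rexp (-(1 / 2) * v ^ 2)) atTop (𝓝 (√(2 * π) / 2)) := by
  have h := intervalIntegral_tendsto_integral_Ioi (0 : ℝ)
    (integrable_exp_neg_mul_sq (b := 1 / 2) (by norm_num)).integrableOn tendsto_id
  rw [integral_gaussian_Ioi] at h
  rwa [div_div_eq_mul_div, div_one, mul_comm π] at h

lemma tendsto_gaussian_primitive_atBot :
    Tendsto (fun u => ∫ v in (0 : ℝ)..u, rexp (-(1 / 2) * v ^ 2)) atBot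
      (𝓝 (-(√(2 * π) / 2))) := by
  have h := (tendsto_gaussian_primitive_atTop.comp tendsto_neg_atBot_atTop).neg
  refine h.congr fun u => ?_
  have := intervalIntegral.integral_comp_neg (a := 0) (b := u)
    (fun v : ℝ => rexp (-(1 / 2) * v ^ 2))
  simp only [neg_sq, neg_zero] at this
  rw [this, intervalIntegral.integral_symm]
  simp

lemma integral_inverse_gaussian {m x : ℝ} (hm : 0 < m) (hx : 0 < x) :
    IntegrableOn (fun l => (√(2 * π * l))⁻¹ * rexp (-(x ^ 2 / (2 * l))) *
      rexp (-(m ^ 2 * l / 2))) (Ioi 0) ∧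
    ∫ l in Ioi 0, (√(2 * π * l))⁻¹ * rexp (-(x ^ 2 / (2 * l))) * rexp (-(m ^ 2 * l / 2)) =
      rexp (-(m * x)) / m := by
  set G : ℝ → ℝ := fun u => ∫ v in (0 : ℝ)..u, rexp (-(1 / 2) * v ^ 2) with hG
  set J := √(2 * π) / 2 with hJ
  have hsqrt_pos : 0 < √(2 * π) := by positivity
  set g : ℝ → ℝ := fun l => (√(2 * π) * m)⁻¹ * (rexp (-(m * x)) * G (m * √l - x / √l) +
    rexp (m * x) * G (m * √l + x / √l)) with hg
  set L := (√(2 * π) * m)⁻¹ * (rexp (-(m * x)) * -J + rexp (m * x) * J) with hL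
  set M := (√(2 * π) * m)⁻¹ * (rexp (-(m * x)) * J + rexp (m * x) * J) with hM
  have hderiv : ∀ l ∈ Ioi (0 : ℝ), HasDerivAt g ((√(2 * π * l))⁻¹ * rexp (-(x ^ 2 / (2 * l))) *
      rexp (-(m ^ 2 * l / 2))) l := by
    intro l hl
    have hl : 0 < l := hl
    have ht : 0 < √l := sqrt_pos.mpr hl
    have hs : HasDerivAt (fun l => √l) (1 / (2 * √l)) l := hasDerivAt_sqrt hl.ne'
    have h1 := (hasDerivAt_gaussian_primitive (m * √l - x / √l)).comp l
      ((hs.const_mul m).sub ((hasDerivAt_const l x).div hs ht.ne'))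
    have h2 := (hasDerivAt_gaussian_primitive (m * √l + x / √l)).comp l
      ((hs.const_mul m).add ((hasDerivAt_const l x).div hs ht.ne'))
    have h3 := ((h1.const_mul (rexp (-(m * x)))).add (h2.const_mul (rexp (m * x)))).const_mul
      (√(2 * π) * m)⁻¹
    refine h3.congr_deriv ?_
    have hsq : √l ^ 2 = l := Real.sq_sqrt hl.le
    have e1 : rexp (-(m * x)) * rexp (-(1 / 2) * (m * √l - x / √l) ^ 2) =
        rexp (-(x ^ 2 / (2 * l))) * rexp (-(m ^ 2 * l / 2)) := by
      rw [← Real.exp_add, ← Real.exp_add, ← hsq]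
      congr 1
      rw [Real.sqrt_sq ht.le]
      field_simp
      ring
    have e2 : rexp (m * x) * rexp (-(1 / 2) * (m * √l + x / √l) ^ 2) =
        rexp (-(x ^ 2 / (2 * l))) * rexp (-(m ^ 2 * l / 2)) := by
      rw [← Real.exp_add, ← Real.exp_add, ← hsq]
      congr 1
      rw [Real.sqrt_sq ht.le]
      field_simp
      ring
    rw [← mul_assoc, ← mul_assoc, e1, e2, Real.sqrt_mul (by positivity) l]
    field_simp
    ring
  have hpos : ∀ l ∈ Ioi (0 : ℝ), 0 ≤ (√(2 * π * l))⁻¹ * rexp (-(x ^ 2 / (2 * l))) *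
      rexp (-(m ^ 2 * l / 2)) := fun l _ => by positivity
  have hsinf : Tendsto (fun l => √l) atTop atTop := tendsto_sqrt_atTop
  have htop : Tendsto g atTop (𝓝 M) := by
    have hd : Tendsto (fun l => x / √l) atTop (𝓝 0) := hsinf.const_div_atTop x
    have hm' : Tendsto (fun l => m * √l) atTop atTop := hsinf.const_mul_atTop hm
    have a1 : Tendsto (fun l => m * √l - x / √l) atTop atTop := by
      simpa only [sub_eq_add_neg] using hm'.atTop_add hd.neg
    have a2 : Tendsto (fun l => m * √l + x / √l) atTop atTop := hm'.atTop_add hd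
    exact (((tendsto_gaussian_primitive_atTop.comp a1).const_mul _).add
      ((tendsto_gaussian_primitive_atTop.comp a2).const_mul _)).const_mul _
  have hzero : Tendsto g (𝓝[>] 0) (𝓝 L) := by
    have hs0 : Tendsto (fun l => √l) (𝓝[>] 0) (𝓝[>] 0) := by
      refine tendsto_nhdsWithin_iff.mpr ⟨?_, ?_⟩
      · have := (Real.continuous_sqrt.tendsto 0).mono_left (nhdsWithin_le_nhds (s := Ioi 0))
        simpa using this
      · filter_upwards [self_mem_nhdsWithin] with l hl using sqrt_pos.mpr hl
    have hd : Tendsto (fun l => x / √l) (𝓝[>] 0) atTop := by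
      simpa only [div_eq_mul_inv, Function.comp_def] using
        (tendsto_inv_nhdsGT_zero.comp hs0).const_mul_atTop hx
    have hm' : Tendsto (fun l => m * √l) (𝓝[>] 0) (𝓝 (m * 0)) :=
      (hs0.mono_right nhdsWithin_le_nhds).const_mul m
    have a1 : Tendsto (fun l => m * √l - x / √l) (𝓝[>] 0) atBot := by
      simpa only [sub_eq_add_neg, Function.comp_def] using
        hm'.add_atBot (tendsto_neg_atTop_atBot.comp hd)
    have a2 : Tendsto (fun l => m * √l + x / √l) (𝓝[>] 0) atTop := hm'.add_atTop hd
    exact (((tendsto_gaussian_primitive_atBot.comp a1).const_mul _).add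
      ((tendsto_gaussian_primitive_atTop.comp a2).const_mul _)).const_mul _
  have hcont : ContinuousWithinAt (Function.update g 0 L) (Ici 0) 0 := by
    rw [continuousWithinAt_update_same, Set.Ici_sdiff_left]
    exact hzero
  have hderiv' : ∀ l ∈ Ioi (0 : ℝ), HasDerivAt (Function.update g 0 L)
      ((√(2 * π * l))⁻¹ * rexp (-(x ^ 2 / (2 * l))) * rexp (-(m ^ 2 * l / 2))) l := by
    intro l hl
    refine (hderiv l hl).congr_of_eventuallyEq ?_
    filter_upwards [Ioi_mem_nhds hl] with y hy
    exact Function.update_of_ne (ne_of_gt hy) _ _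
  have htop' : Tendsto (Function.update g 0 L) atTop (𝓝 M) := by
    refine htop.congr' ?_
    filter_upwards [Ioi_mem_atTop 0] with y hy
    exact (Function.update_of_ne (ne_of_gt hy) _ _).symm
  refine ⟨integrableOn_Ioi_deriv_of_nonneg hcont hderiv' hpos htop', ?_⟩
  rw [integral_Ioi_of_hasDerivAt_of_nonneg hcont hderiv' hpos htop', Function.update_self]
  simp only [hM, hL, hJ]
  field_simp
  ring

lemma integrableOn_inv_sqrt_mul_exp_neg_sqrt {c : ℝ} (hc : 0 < c) :
    IntegrableOn (fun l => (√(2 * π * l))⁻¹ * rexp (-(c * √l))) (Ioi 0) := by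
  have hderiv : ∀ l ∈ Ioi (0 : ℝ), HasDerivAt
      (fun l => -(2 / (c * √(2 * π))) * rexp (-(c * √l)))
      ((√(2 * π * l))⁻¹ * rexp (-(c * √l))) l := by
    intro l hl
    have hl : 0 < l := hl
    have ht : 0 < √l := sqrt_pos.mpr hl
    have h := (((hasDerivAt_sqrt hl.ne').const_mul c).neg.exp).const_mul (-(2 / (c * √(2 * π))))
    refine h.congr_deriv ?_
    rw [Real.sqrt_mul (by positivity) l, Pi.neg_apply]
    field_simp
  have hlim : Tendsto (fun l => -(2 / (c * √(2 * π))) * rexp (-(c * √l))) atTop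
      (𝓝 (-(2 / (c * √(2 * π))) * 0)) :=
    (tendsto_exp_neg_atTop_nhds_zero.comp (tendsto_sqrt_atTop.const_mul_atTop hc)).const_mul _
  exact integrableOn_Ioi_deriv_of_nonneg (Continuous.continuousWithinAt (by fun_prop)) hderiv
    (fun l _ => by positivity) hlim

lemma hasSum_thetaKernel {p l : ℝ} (hp : 0 < p) (hl : 0 < l) :
    HasSum (fun k : ℕ => negBinomCoeff p k * (p / 2 + k) * rexp (-((p / 2 + k) ^ 2 * l / 2)))
      (thetaKernel p l) := by
  obtain ⟨C, hC⟩ := summable_and_abs_thetaKernel_le hp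
  have h := (hC (√l) (sqrt_pos.mpr hl)).1
  rw [Real.sq_sqrt hl.le] at h
  exact h.hasSum

lemma exists_abs_thetaKernel_le {p : ℝ} (hp : 0 < p) :
    ∃ C : ℝ, ∀ l : ℝ, 0 < l → |thetaKernel p l| ≤ C * rexp (-(p / 2 * √l)) := by
  obtain ⟨C, hC⟩ := summable_and_abs_thetaKernel_le hp
  refine ⟨C, fun l hl => ?_⟩
  have h := (hC (√l) (sqrt_pos.mpr hl)).2
  rwa [Real.sq_sqrt hl.le] at h

lemma aestronglyMeasurable_thetaKernel {p : ℝ} (hp : 0 < p) :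
    AEStronglyMeasurable (thetaKernel p) (volume.restrict (Ioi 0)) := by
  refine aestronglyMeasurable_of_tendsto_ae atTop
    (f := fun n l => ∑ k ∈ Finset.range n,
      negBinomCoeff p k * (p / 2 + k) * rexp (-((p / 2 + k) ^ 2 * l / 2)))
    (fun n => Continuous.aestronglyMeasurable (by fun_prop)) ?_
  filter_upwards [ae_restrict_mem measurableSet_Ioi] with l hl
  exact (hasSum_thetaKernel hp hl).tendsto_sum_nat

lemma integral_thetaKernel_of_pos {p x : ℝ} (hp : 0 < p) (hx : 0 < x) :
    ∫ l in Ioi 0, (√(2 * π * l))⁻¹ * rexp (-(x ^ 2 / (2 * l))) * thetaKernel p l =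
      rexp (-(p / 2 * x)) * (1 + rexp (-x)) ^ (-p) := by
  have hm : ∀ k : ℕ, 0 < p / 2 + k := fun k => by positivity
  set F : ℕ → ℝ → ℝ := fun k l => negBinomCoeff p k * (p / 2 + k) *
    ((√(2 * π * l))⁻¹ * rexp (-(x ^ 2 / (2 * l))) * rexp (-((p / 2 + k) ^ 2 * l / 2))) with hF
  have hx1 : rexp (-x) < 1 := by simpa using hx
  have hexp : ∀ k : ℕ, rexp (-((p / 2 + k) * x)) = rexp (-(p / 2 * x)) * rexp (-x) ^ k := by
    intro k
    rw [← Real.exp_nat_mul, ← Real.exp_add]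
    congr 1
    ring
  have hF_int : ∀ k, Integrable (F k) (volume.restrict (Ioi 0)) := fun k =>
    (integral_inverse_gaussian (hm k) hx).1.const_mul _
  have hval : ∀ k, ∫ l in Ioi 0, F k l =
      rexp (-(p / 2 * x)) * (negBinomCoeff p k * rexp (-x) ^ k) := by
    intro k
    simp only [hF]
    rw [integral_const_mul, (integral_inverse_gaussian (hm k) hx).2, hexp]
    have := (hm k).ne'
    field_simp
  have hnorm : ∀ k, ∫ l in Ioi 0, ‖F k l‖ =
      rexp (-(p / 2 * x)) * ‖negBinomCoeff p k * rexp (-x) ^ k‖ := by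
    intro k
    have : ∀ l, ‖F k l‖ = |negBinomCoeff p k| * (p / 2 + k) *
        ((√(2 * π * l))⁻¹ * rexp (-(x ^ 2 / (2 * l))) * rexp (-((p / 2 + k) ^ 2 * l / 2))) := by
      intro l
      simp only [hF]
      rw [Real.norm_eq_abs, abs_mul, abs_mul, abs_of_pos (hm k)]
      congr 1
      exact abs_of_nonneg (by positivity)
    simp only [this]
    rw [integral_const_mul, (integral_inverse_gaussian (hm k) hx).2, hexp, Real.norm_eq_abs,
      abs_mul, abs_of_nonneg (by positivity : 0 ≤ rexp (-x) ^ k)]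
    have := (hm k).ne'
    field_simp
  have hbin := hasSum_negBinomCoeff_mul_pow_real p (exp_pos (-x)).le hx1
  have h := hasSum_integral_of_summable_integral_norm hF_int (by
    simp only [hnorm]
    exact hbin.summable.norm.mul_left _)
  simp only [hval] at h
  rw [← h.unique (hbin.mul_left _)]
  refine setIntegral_congr_fun measurableSet_Ioi fun l hl => ?_
  have hs := (hasSum_thetaKernel hp hl).mul_left
    ((√(2 * π * l))⁻¹ * rexp (-(x ^ 2 / (2 * l))))
  simp only [hF]
  rw [← hs.tsum_eq]
  congr 1
  ext k
  ring

lemma integral_thetaKernel_zero {p : ℝ} (hp : 0 < p) :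
    ∫ l in Ioi 0, (√(2 * π * l))⁻¹ * rexp (-(0 ^ 2 / (2 * l))) * thetaKernel p l =
      rexp (-(p / 2 * 0)) * (1 + rexp (-0)) ^ (-p) := by
  obtain ⟨C, hC⟩ := exists_abs_thetaKernel_le hp
  have hlim : Tendsto (fun x => ∫ l in Ioi 0,
      (√(2 * π * l))⁻¹ * rexp (-(x ^ 2 / (2 * l))) * thetaKernel p l) (𝓝[>] 0)
      (𝓝 (∫ l in Ioi 0,
        (√(2 * π * l))⁻¹ * rexp (-(0 ^ 2 / (2 * l))) * thetaKernel p l)) := by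
    refine tendsto_integral_filter_of_dominated_convergence
      (fun l => C * ((√(2 * π * l))⁻¹ * rexp (-(p / 2 * √l)))) ?_ ?_ ?_ ?_
    · exact Eventually.of_forall fun x =>
        (Measurable.aestronglyMeasurable (by fun_prop)).mul (aestronglyMeasurable_thetaKernel hp)
    · refine Eventually.of_forall fun x => ?_
      filter_upwards [ae_restrict_mem measurableSet_Ioi] with l hl
      have hl : 0 < l := hl
      have h1 : rexp (-(x ^ 2 / (2 * l))) ≤ 1 := by
        rw [exp_le_one_iff, neg_nonpos]
        positivity
      rw [Real.norm_eq_abs, abs_mul, abs_of_nonneg (by positivity)]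
      calc _ ≤ (√(2 * π * l))⁻¹ * 1 * (C * rexp (-(p / 2 * √l))) := by
            gcongr
            exact hC l hl
        _ = _ := by ring
    · exact (integrableOn_inv_sqrt_mul_exp_neg_sqrt (by positivity)).const_mul C
    · refine Eventually.of_forall fun l => ?_
      refine Tendsto.mono_left ?_ nhdsWithin_le_nhds
      exact Continuous.tendsto (f := fun x : ℝ =>
        (√(2 * π * l))⁻¹ * rexp (-(x ^ 2 / (2 * l))) * thetaKernel p l) (by fun_prop) 0
  have hlim' : Tendsto (fun x => rexp (-(p / 2 * x)) * (1 + rexp (-x)) ^ (-p)) (𝓝[>] 0)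
      (𝓝 (rexp (-(p / 2 * 0)) * (1 + rexp (-0)) ^ (-p))) := by
    refine Tendsto.mono_left ?_ nhdsWithin_le_nhds
    have hc : Continuous fun x => rexp (-(p / 2 * x)) * (1 + rexp (-x)) ^ (-p) := by
      refine Continuous.mul (by fun_prop) (Continuous.rpow_const (by fun_prop) fun x => ?_)
      exact Or.inl (by positivity)
    exact hc.tendsto 0
  refine tendsto_nhds_unique hlim (hlim'.congr' ?_)
  filter_upwards [self_mem_nhdsWithin] with x hx
  exact (integral_thetaKernel_of_pos hp hx).symm

lemma exp_mul_one_add_exp_rpow_neg (p x : ℝ) :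
    rexp (-(p / 2 * x)) * (1 + rexp (-x)) ^ (-p) = rexp (p / 2 * x) * (1 + rexp x) ^ (-p) := by
  have h : 1 + rexp (-x) = rexp (-x) * (1 + rexp x) := by
    rw [mul_add, ← Real.exp_add]
    simp [add_comm]
  rw [h, Real.mul_rpow (exp_pos _).le (by positivity), ← Real.exp_mul, ← mul_assoc,
    ← Real.exp_add]
  congr 2
  ring

lemma integral_thetaKernel {p : ℝ} (hp : 0 < p) (x : ℝ) :
    ∫ l in Ioi 0, (√(2 * π * l))⁻¹ * rexp (-(x ^ 2 / (2 * l))) * thetaKernel p l =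
      rexp (p / 2 * x) * (1 + rexp x) ^ (-p) := by
  rcases lt_trichotomy x 0 with hx | rfl | hx
  · have h := integral_thetaKernel_of_pos hp (neg_pos.mpr hx)
    simpa using h
  · rw [integral_thetaKernel_zero hp, exp_mul_one_add_exp_rpow_neg]
  · rw [integral_thetaKernel_of_pos hp hx, exp_mul_one_add_exp_rpow_neg]

lemma exp_mul_polya (a b l : ℝ) :
    rexp (-(((a - b) / 2) ^ 2 * l / 2)) * polya a b l =
      (betaFn a b)⁻¹ * thetaKernel (a + b) l := by
  rw [polya, thetaKernel, ← tsum_mul_left, ← tsum_mul_left]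
  congr 1
  ext k
  have h : rexp (-(((a + b) / 2 + k) ^ 2 * l / 2)) =
      rexp (-(((a - b) / 2) ^ 2 * l / 2)) * rexp (-((a + k) * (b + k) * l / 2)) := by
    rw [← Real.exp_add]
    congr 1
    ring
  rw [h, polyaWeight, negBinomCoeff]
  ring

end

/-- The `z`-distribution density admits a normal variance-mean scale mixture
representation over the Polya density `q_{a,b}`. -/
theorem zdist_scale_mixture (a b σ μ z : ℝ) (ha : 0 < a) (hb : 0 < b) (hσ : 0 < σ) :
    (1 / (σ * betaFn a b)) * Real.exp (a * (z - μ) / σ) /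
        (1 + Real.exp ((z - μ) / σ)) ^ (a + b) =
      ∫ lam in Set.Ioi (0 : ℝ),
        (2 * Real.pi * lam * σ ^ 2) ^ (-(1 : ℝ) / 2) *
          Real.exp (-(z - μ - (1 / 2) * (a - b) * lam * σ) ^ 2 / (2 * lam * σ ^ 2)) *
          polya a b lam := by
  set x := (z - μ) / σ with hx
  have hzx : z - μ = σ * x := by rw [hx]; field_simp
  have hF_int : ∀ l ∈ Set.Ioi (0 : ℝ),
      (2 * Real.pi * l * σ ^ 2) ^ (-(1 : ℝ) / 2) *
        Real.exp (-(z - μ - (1 / 2) * (a - b) * l * σ) ^ 2 / (2 * l * σ ^ 2)) * polya a b l =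
      (σ⁻¹ * Real.exp ((a - b) / 2 * x) * (betaFn a b)⁻¹) *
        ((√(2 * Real.pi * l))⁻¹ * Real.exp (-(x ^ 2 / (2 * l))) * thetaKernel (a + b) l) := by
    intro l hl
    have hl : 0 < l := hl
    have h1 : (2 * Real.pi * l * σ ^ 2) ^ (-(1 : ℝ) / 2) = σ⁻¹ * (√(2 * Real.pi * l))⁻¹ := by
      rw [neg_div, Real.rpow_neg (by positivity), ← Real.sqrt_eq_rpow,
        Real.sqrt_mul (by positivity), Real.sqrt_sq hσ.le, mul_inv, mul_comm]
    have h2 : Real.exp (-(z - μ - (1 / 2) * (a - b) * l * σ) ^ 2 / (2 * l * σ ^ 2)) =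
        Real.exp ((a - b) / 2 * x) * Real.exp (-(x ^ 2 / (2 * l))) *
          Real.exp (-(((a - b) / 2) ^ 2 * l / 2)) := by
      rw [← Real.exp_add, ← Real.exp_add, hzx]
      congr 1
      field_simp
      ring
    rw [h1, h2]
    linear_combination σ⁻¹ * (√(2 * Real.pi * l))⁻¹ * Real.exp ((a - b) / 2 * x) *
      Real.exp (-(x ^ 2 / (2 * l))) * exp_mul_polya a b l
  rw [MeasureTheory.setIntegral_congr_fun measurableSet_Ioi hF_int,
    MeasureTheory.integral_const_mul, integral_thetaKernel (by positivity),
    Real.rpow_neg (by positivity)]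
  have h3 : Real.exp (a * (z - μ) / σ) =
      Real.exp ((a - b) / 2 * x) * Real.exp ((a + b) / 2 * x) := by
    rw [← Real.exp_add, mul_div_assoc, ← hx]
    congr 1
    ring
  rw [h3, one_div, mul_inv]
  ring
end

section
/- Let a, b > 0 with a + b = κ, and let μ ∈ ℝ. Then (1/B(a,b)) · e^{−aμ} · (1 + e^{−μ})^{−κ} = ∫_0^∞ (2πλ)^{-1/2} · exp( −(μ + (1/2)(a−b)λ)² / (2λ) ) · q_{a,b}(λ) dλ. Equivalently, (1 + e^{−μ})^{−κ} = B(a,b) · e^{aμ} · ∫_0^∞ (2πλ)^{-1/2} exp( −(μ + (1/2)(a−b)λ)²/(2λ) ) q_{a,b}(λ) dλ. (This is the paper's pdf representation of the powered logistic likelihood, obtained by evaluating the z-distribution scale-mixture density at z = 0.) -/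
open MeasureTheory Filter Topology

/-- The binomial series of `(1 - y)⁻ᵏ` with rising-factorial coefficients. -/
theorem hasSum_rising_div_factorial_mul_pow (κ : ℝ) {y : ℝ} (hy : |y| < 1) :
    HasSum (fun n : ℕ => (∏ i ∈ Finset.range n, (κ + i)) / (n.factorial : ℝ) * y ^ n)
      (1 / (1 - y) ^ κ) := by
  have h := (Real.one_div_one_sub_rpow_hasFPowerSeriesOnBall_zero κ).hasSum (y := y)
    (by simpa [enorm_eq_nnnorm, ← NNReal.coe_lt_coe] using hy)
  simp only [zero_add] at h
  refine h.congr_fun fun n => ?_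
  rw [FormalMultilinearSeries.ofScalars_apply_eq, smul_eq_mul]
  congr 1
  rw [← Ring.multichoose_eq, div_eq_iff (by positivity), mul_comm, ← nsmul_eq_mul,
    Ring.factorial_nsmul_multichoose_eq_ascPochhammer, Polynomial.ascPochhammer_smeval_eq_eval]
  induction n with
  | zero => simp
  | succ n ih => rw [Finset.prod_range_succ, ih, ascPochhammer_succ_eval]

/-- The factor `∏_{i<k} (n-i)/(κ+n+1+i)` by which the `k`-th Polya weight is damped when the
infinite convolution of exponential laws is truncated after `n + 1` factors. -/
noncomputable def truncationFactor (κ : ℝ) (n k : ℕ) : ℝ :=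
  ∏ i ∈ Finset.range k, ((n : ℝ) - i) / (κ + n + 1 + i)

theorem truncationFactor_succ (κ : ℝ) (n k : ℕ) :
    truncationFactor κ n (k + 1) = truncationFactor κ n k * (((n : ℝ) - k) / (κ + n + 1 + k)) :=
  Finset.prod_range_succ _ _

theorem truncationFactor_eq_zero (κ : ℝ) {n k : ℕ} (h : n < k) : truncationFactor κ n k = 0 :=
  Finset.prod_eq_zero (Finset.mem_range.2 h) (by simp)

theorem abs_truncationFactor_le_one {κ : ℝ} (hκ : 0 < κ) (n k : ℕ) :
    |truncationFactor κ n k| ≤ 1 := by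
  rcases lt_or_ge n k with h | h
  · simp [truncationFactor_eq_zero κ h]
  · rw [truncationFactor, Finset.abs_prod]
    refine Finset.prod_le_one (fun _ _ => abs_nonneg _) fun i hi => ?_
    have hi' : (i : ℝ) ≤ n := by exact_mod_cast ((Finset.mem_range.1 hi).le.trans h)
    rw [abs_of_nonneg (div_nonneg (by linarith) (by positivity)), div_le_one (by positivity)]
    linarith [i.cast_nonneg (α := ℝ)]

theorem tendsto_truncationFactor (κ : ℝ) (k : ℕ) :
    Tendsto (fun n : ℕ => truncationFactor κ n k) atTop (𝓝 1) := by
  have h : ∀ i ∈ Finset.range k,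
      Tendsto (fun n : ℕ => ((n : ℝ) - i) / (κ + n + 1 + i)) atTop (𝓝 1) := fun i _ => by
    have := tendsto_add_mul_div_add_mul_atTop_nhds (𝕜 := ℝ) (-i) (κ + 1 + i) 1 one_ne_zero
      (d := 1)
    refine (by simpa using this : Tendsto _ _ (𝓝 (1 : ℝ))).congr fun n => ?_
    congr 1 <;> ring
  simpa [truncationFactor] using tendsto_finsetProd _ h

theorem truncationFactor_recurrence {κ : ℝ} (hκ : 0 < κ) (n k : ℕ) :
    ((n : ℝ) + 1 - k) * (κ + n + 1 + k) * truncationFactor κ (n + 1) k =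
      (n + 1) * (κ + n + 1) * truncationFactor κ n k := by
  induction k with
  | zero => simp [truncationFactor]
  | succ k ih =>
    have h₁ : κ + n + 1 + k ≠ 0 := by positivity
    have h₂ : κ + (n + 1) + 1 + k ≠ 0 := by positivity
    rw [truncationFactor_succ, truncationFactor_succ, ← mul_assoc _ (truncationFactor κ n k), ← ih]
    push_cast
    field_simp
    ring

/-- Up to a positive factor, the `k`-th partial-fraction coefficient of the density of a sum of
`n + 1` independent exponential variables with rates `ψ_0, …, ψ_n`. -/
noncomputable def truncatedWeight (κ : ℝ) (n k : ℕ) : ℝ :=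
  (-1) ^ k * ((∏ i ∈ Finset.range k, (κ + i)) / (k.factorial : ℝ)) * (κ + 2 * k) *
    truncationFactor κ n k

theorem sum_truncatedWeight {κ : ℝ} (hκ : 0 < κ) (n K : ℕ) :
    n * ∑ k ∈ Finset.range (K + 1), truncatedWeight κ n k =
      (-1) ^ K * (∏ i ∈ Finset.range (K + 1), (κ + i)) / (K.factorial : ℝ) *
        truncationFactor κ n K * (n - K) := by
  induction K with
  | zero => simp [truncatedWeight, truncationFactor]; ring
  | succ K ih =>
    have h₁ : κ + n + 1 + K ≠ 0 := by positivity
    rw [Finset.sum_range_succ, mul_add, ih, truncatedWeight, truncationFactor_succ,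
      Finset.prod_range_succ _ (K + 1), Nat.factorial_succ, pow_succ]
    push_cast
    field_simp
    ring

theorem sum_truncatedWeight_succ {κ : ℝ} (hκ : 0 < κ) (n : ℕ) :
    ∑ k ∈ Finset.range (n + 2), truncatedWeight κ (n + 1) k = 0 := by
  have h := sum_truncatedWeight hκ (n + 1) (n + 1)
  rw [sub_self, mul_zero] at h
  exact (mul_eq_zero.1 h).resolve_left (by positivity)

theorem sum_truncatedWeight_mul_exp_nonneg {a b : ℝ} (ha : 0 < a) (hb : 0 < b) (n : ℕ) :
    ∀ t : ℝ, 0 ≤ t → 0 ≤ ∑ k ∈ Finset.range (n + 1),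
      truncatedWeight (a + b) n k * Real.exp (-((a + k) * (b + k)) * t) := by
  have hκ : 0 < a + b := by positivity
  induction n with
  | zero =>
    intro t _
    simp only [zero_add, Finset.sum_range_one, truncatedWeight, truncationFactor,
      Finset.range_zero, Finset.prod_empty]
    simp
    positivity
  | succ n ih =>
    intro t ht
    obtain ⟨ψ, hψ⟩ : ∃ ψ : ℕ → ℝ, ∀ k : ℕ, ψ k = (a + k) * (b + k) := ⟨_, fun _ => rfl⟩
    simp only [← hψ] at ih ⊢
    set G : ℝ → ℝ := fun s => ∑ k ∈ Finset.range (n + 2),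
      truncatedWeight (a + b) (n + 1) k * Real.exp ((ψ (n + 1) - ψ k) * s) with hG
    obtain ⟨C, hC⟩ : ∃ C : ℝ, C = (n + 1) * (a + b + n + 1) := ⟨_, rfl⟩
    have hC0 : 0 < C := hC ▸ by positivity
    have hrec : ∀ k, truncatedWeight (a + b) (n + 1) k * (ψ (n + 1) - ψ k) =
        C * truncatedWeight (a + b) n k := fun k => by
      have h := truncationFactor_recurrence hκ n k
      have h' : ψ (n + 1) - ψ k = ((n : ℝ) + 1 - k) * (a + b + n + 1 + k) := by
        rw [hψ, hψ]; push_cast; ring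
      rw [h', hC, truncatedWeight, truncatedWeight]
      linear_combination ((-1) ^ k * ((∏ i ∈ Finset.range k, (a + b + (i : ℝ))) /
        (k.factorial : ℝ)) * (a + b + 2 * k)) * h
    have hderiv : ∀ s, HasDerivAt G (C * (Real.exp (ψ (n + 1) * s) *
        ∑ k ∈ Finset.range (n + 1), truncatedWeight (a + b) n k * Real.exp (-(ψ k) * s))) s := by
      intro s
      have h : HasDerivAt G (∑ k ∈ Finset.range (n + 2), truncatedWeight (a + b) (n + 1) k *
          (Real.exp ((ψ (n + 1) - ψ k) * s) * ((ψ (n + 1) - ψ k) * 1))) s :=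
        HasDerivAt.fun_sum fun k _ => (((hasDerivAt_id s).const_mul _).exp.const_mul _)
      convert h using 1
      rw [Finset.sum_range_succ _ (n + 1), sub_self, zero_mul, zero_mul, mul_zero, mul_zero, add_zero,
        Finset.mul_sum, Finset.mul_sum]
      refine Finset.sum_congr rfl fun k _ => ?_
      rw [show (ψ (n + 1) - ψ k) * s = ψ (n + 1) * s + -ψ k * s by ring, Real.exp_add]
      linear_combination (-(Real.exp (ψ (n + 1) * s) * Real.exp (-ψ k * s))) * hrec k
    have hmono : MonotoneOn G (Set.Ici 0) := by
      refine monotoneOn_of_deriv_nonneg (convex_Ici 0)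
        (fun s _ => (hderiv s).continuousAt.continuousWithinAt)
        (fun s _ => (hderiv s).differentiableAt.differentiableWithinAt) fun s hs => ?_
      rw [interior_Ici] at hs
      rw [(hderiv s).deriv]
      exact mul_nonneg hC0.le (mul_nonneg (Real.exp_pos _).le (ih s hs.le))
    have h0 : G 0 = 0 := by simpa [hG] using sum_truncatedWeight_succ hκ n
    have hGt : 0 ≤ G t := h0 ▸ hmono (Set.self_mem_Ici) ht ht
    have : ∑ k ∈ Finset.range (n + 2), truncatedWeight (a + b) (n + 1) k * Real.exp (-ψ k * t) =
        Real.exp (-(ψ (n + 1) * t)) * G t := by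
      rw [hG, Finset.mul_sum]
      refine Finset.sum_congr rfl fun k _ => ?_
      rw [mul_left_comm, ← Real.exp_add]
      congr 2; ring
    exact this ▸ mul_nonneg (Real.exp_pos _).le hGt

theorem betaFn_pos {a b : ℝ} (ha : 0 < a) (hb : 0 < b) : 0 < betaFn a b :=
  div_pos (mul_pos (Real.Gamma_pos_of_pos ha) (Real.Gamma_pos_of_pos hb))
    (Real.Gamma_pos_of_pos (add_pos ha hb))

theorem norm_polyaWeight {a b : ℝ} (ha : 0 < a) (hb : 0 < b) (k : ℕ) :
    ‖polyaWeight a b k‖ = (∏ i ∈ Finset.range k, (a + b + i)) / (k.factorial : ℝ) *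
      ((a + b) / 2 + k) / betaFn a b := by
  have hB := betaFn_pos ha hb
  have hp : 0 ≤ ∏ i ∈ Finset.range k, (a + b + (i : ℝ)) :=
    Finset.prod_nonneg fun i _ => by positivity
  rw [polyaWeight, mul_div_assoc ((-1 : ℝ) ^ k), mul_assoc, mul_div_assoc, norm_mul, norm_pow,
    norm_neg, norm_one, one_pow, one_mul, Real.norm_of_nonneg (by positivity)]

theorem summable_norm_polyaWeight_mul_exp {a b lam : ℝ} (ha : 0 < a) (hb : 0 < b)
    (hlam : 0 < lam) :
    Summable fun k : ℕ => ‖polyaWeight a b k‖ * Real.exp (-((a + k) * (b + k) * lam / 2)) := by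
  have hB := betaFn_pos ha hb
  set ε := (a + b) * lam / 4 with hε
  have hε0 : 0 < ε := by positivity
  have hs := (hasSum_rising_div_factorial_mul_pow (a + b) (y := Real.exp (-ε))
    (by rw [abs_of_pos (Real.exp_pos _)]; simpa using hε0)).summable.mul_left
      (((a + b) / 2 + 1 / ε) / betaFn a b)
  refine hs.of_nonneg_of_le (fun k => by positivity) fun k => ?_
  have hp : 0 ≤ ∏ i ∈ Finset.range k, (a + b + (i : ℝ)) :=
    Finset.prod_nonneg fun i _ => by positivity
  have h₁ : (a + b) / 2 + k ≤ ((a + b) / 2 + 1 / ε) * Real.exp (ε * k) := by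
    have h := Real.add_one_le_exp (ε * k)
    have h1 : (1 : ℝ) ≤ Real.exp (ε * k) := Real.one_le_exp (by positivity)
    have h2 : (k : ℝ) ≤ 1 / ε * Real.exp (ε * k) := by
      rw [one_div, ← div_eq_inv_mul, le_div_iff₀ hε0]; linarith
    nlinarith
  have h₂ : Real.exp (-((a + k) * (b + k) * lam / 2)) ≤
      Real.exp (-(ε * k)) * Real.exp (-ε) ^ k := by
    rw [← Real.exp_nat_mul, ← Real.exp_add, Real.exp_le_exp]
    have : 0 ≤ (a * b + (k : ℝ) ^ 2) * lam := by positivity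
    rw [hε]; nlinarith
  rw [norm_polyaWeight ha hb]
  calc _ ≤ (∏ i ∈ Finset.range k, (a + b + (i : ℝ))) / (k.factorial : ℝ) *
        (((a + b) / 2 + 1 / ε) * Real.exp (ε * k)) / betaFn a b *
          (Real.exp (-(ε * k)) * Real.exp (-ε) ^ k) := by gcongr
    _ = _ := by
      rw [Real.exp_neg (ε * k)]
      have := (Real.exp_pos (ε * k)).ne'
      field_simp

theorem polya_nonneg {a b lam : ℝ} (ha : 0 < a) (hb : 0 < b) (hlam : 0 < lam) :
    0 ≤ polya a b lam := by
  have hB := betaFn_pos ha hb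
  have hκ : 0 < a + b := by positivity
  have hlim := tendsto_tsum_of_dominated_convergence (𝓕 := atTop)
    (f := fun n k : ℕ => polyaWeight a b k * Real.exp (-((a + k) * (b + k) * lam / 2)) *
      truncationFactor (a + b) n k)
    (g := fun k => polyaWeight a b k * Real.exp (-((a + k) * (b + k) * lam / 2)))
    (summable_norm_polyaWeight_mul_exp ha hb hlam)
    (fun k => by
      simpa using (tendsto_truncationFactor (a + b) k).const_mul
        (polyaWeight a b k * Real.exp (-((a + k) * (b + k) * lam / 2))))
    (Eventually.of_forall fun n k => by
      rw [norm_mul, norm_mul, Real.norm_of_nonneg (Real.exp_pos _).le]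
      exact mul_le_of_le_one_right (by positivity) (abs_truncationFactor_le_one hκ n k))
  refine ge_of_tendsto' hlim fun n => ?_
  rw [tsum_eq_sum (s := Finset.range (n + 1)) fun k hk => by
    rw [truncationFactor_eq_zero _ (by simpa using hk), mul_zero]]
  have h := sum_truncatedWeight_mul_exp_nonneg ha hb n (lam / 2) (by positivity)
  refine (div_nonneg h (by positivity : 0 ≤ 2 * betaFn a b)).trans_eq ?_
  rw [Finset.sum_div]
  refine Finset.sum_congr rfl fun k _ => ?_
  rw [truncatedWeight, polyaWeight,
    show -((a + k) * (b + k) * lam / 2) = -((a + (k : ℝ)) * (b + k)) * (lam / 2) by ring]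
  field_simp

/-- If `g` is differentiable on `(0, ∞)` with nonnegative derivative and has finite limits at both
ends, then its derivative is integrable and integrates to the difference of the limits. -/
theorem integrableOn_and_integral_Ioi_of_hasDerivAt_of_tendsto {g g' : ℝ → ℝ} {l₀ l : ℝ}
    (hderiv : ∀ x ∈ Set.Ioi (0 : ℝ), HasDerivAt g (g' x) x)
    (hpos : ∀ x ∈ Set.Ioi (0 : ℝ), 0 ≤ g' x)
    (h₀ : Tendsto g (𝓝[>] 0) (𝓝 l₀)) (h : Tendsto g atTop (𝓝 l)) :
    IntegrableOn g' (Set.Ioi 0) ∧ ∫ x in Set.Ioi 0, g' x = l - l₀ := by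
  have hcont : ContinuousWithinAt (Function.update g 0 l₀) (Set.Ici 0) 0 := by
    rwa [continuousWithinAt_update_same, Set.Ici_sdiff_left]
  have hderiv' : ∀ x ∈ Set.Ioi (0 : ℝ), HasDerivAt (Function.update g 0 l₀) (g' x) x := by
    intro x hx
    refine (hderiv x hx).congr_of_eventuallyEq ?_
    filter_upwards [eventually_ne_nhds (ne_of_gt hx)] with y hy
    exact Function.update_of_ne hy _ _
  have h' : Tendsto (Function.update g 0 l₀) atTop (𝓝 l) := by
    refine h.congr' ?_
    filter_upwards [eventually_gt_atTop 0] with y hy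
    exact (Function.update_of_ne hy.ne' _ _).symm
  refine ⟨integrableOn_Ioi_deriv_of_nonneg hcont hderiv' hpos h', ?_⟩
  simpa using integral_Ioi_of_hasDerivAt_of_nonneg hcont hderiv' hpos h'

theorem tendsto_integral_gaussian_atTop :
    Tendsto (fun x : ℝ => ∫ t in (0 : ℝ)..x, Real.exp (-(1 / 2) * t ^ 2)) atTop
      (𝓝 (√(2 * Real.pi) / 2)) := by
  have h := intervalIntegral_tendsto_integral_Ioi (0 : ℝ)
    (integrable_exp_neg_mul_sq (b := 1 / 2) (by norm_num)).integrableOn tendsto_id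
  rwa [integral_gaussian_Ioi, show Real.pi / (1 / 2) = 2 * Real.pi by ring] at h

theorem tendsto_integral_gaussian_atBot :
    Tendsto (fun x : ℝ => ∫ t in (0 : ℝ)..x, Real.exp (-(1 / 2) * t ^ 2)) atBot
      (𝓝 (-(√(2 * Real.pi) / 2))) := by
  refine ((tendsto_integral_gaussian_atTop.comp tendsto_neg_atBot_atTop).neg).congr fun x => ?_
  have h := intervalIntegral.integral_comp_neg (a := x) (b := 0)
    (fun t : ℝ => Real.exp (-(1 / 2) * t ^ 2))
  simp only [neg_zero, even_two.neg_pow] at h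
  rw [Function.comp_apply, ← h, ← intervalIntegral.integral_symm]

/-- The Gaussian scale mixture with inverse-Gaussian type weight: both integrability and the value
of `∫₀^∞ (2πx)^{-1/2} exp(-m²/(2x) - c²x/2) dx = e^{-cm}/c`. -/
theorem integrableOn_and_integral_gaussian_scale_mixture {c m : ℝ} (hc : 0 < c) (hm : 0 < m) :
    IntegrableOn (fun x : ℝ => (2 * Real.pi * x) ^ (-(1 : ℝ) / 2) *
        Real.exp (-m ^ 2 / (2 * x) - c ^ 2 * x / 2)) (Set.Ioi 0) ∧
      ∫ x in Set.Ioi (0 : ℝ), (2 * Real.pi * x) ^ (-(1 : ℝ) / 2) *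
        Real.exp (-m ^ 2 / (2 * x) - c ^ 2 * x / 2) = Real.exp (-(c * m)) / c := by
  set G : ℝ → ℝ := fun x => ∫ t in (0 : ℝ)..x, Real.exp (-(1 / 2) * t ^ 2) with hG
  have hcont : Continuous fun t : ℝ => Real.exp (-(1 / 2) * t ^ 2) := by fun_prop
  have hGd : ∀ x, HasDerivAt G (Real.exp (-(1 / 2) * x ^ 2)) x := fun x =>
    intervalIntegral.integral_hasDerivAt_right (hcont.intervalIntegrable _ _)
      (hcont.stronglyMeasurableAtFilter _ _) hcont.continuousAt
  have hs0 : Tendsto (fun x : ℝ => √x) (𝓝[>] 0) (𝓝[>] 0) :=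
    tendsto_nhdsWithin_iff.2 ⟨by simpa using
      (Real.continuous_sqrt.tendsto 0).mono_left nhdsWithin_le_nhds,
      by filter_upwards [self_mem_nhdsWithin] with x hx using Real.sqrt_pos.2 hx⟩
  have hi0 : Tendsto (fun x : ℝ => m * (√x)⁻¹) (𝓝[>] 0) atTop :=
    (tendsto_inv_nhdsGT_zero.comp hs0).const_mul_atTop hm
  have hc0 : Tendsto (fun x : ℝ => c * √x) (𝓝[>] 0) (𝓝 0) := by
    simpa using (hs0.mono_right nhdsWithin_le_nhds).const_mul c
  have hi1 : Tendsto (fun x : ℝ => m * (√x)⁻¹) atTop (𝓝 0) := by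
    simpa using (tendsto_inv_atTop_zero.comp Real.tendsto_sqrt_atTop).const_mul m
  have hc1 : Tendsto (fun x : ℝ => c * √x) atTop atTop :=
    Real.tendsto_sqrt_atTop.const_mul_atTop hc
  have hA0 : Tendsto (fun x : ℝ => c * √x - m * (√x)⁻¹) (𝓝[>] 0) atBot := by
    simpa [sub_eq_add_neg] using hc0.add_atBot (tendsto_neg_atTop_atBot.comp hi0)
  have hB0 : Tendsto (fun x : ℝ => -(c * √x + m * (√x)⁻¹)) (𝓝[>] 0) atBot :=
    tendsto_neg_atTop_atBot.comp (hc0.add_atTop hi0)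
  have hA1 : Tendsto (fun x : ℝ => c * √x - m * (√x)⁻¹) atTop atTop := by
    simpa [sub_eq_add_neg] using hc1.atTop_add hi1.neg
  have hB1 : Tendsto (fun x : ℝ => -(c * √x + m * (√x)⁻¹)) atTop atBot :=
    tendsto_neg_atTop_atBot.comp (hc1.atTop_add hi1)
  have hp : 0 < √(2 * Real.pi) := by positivity
  set F : ℝ → ℝ := fun x => (Real.exp (-(c * m)) * G (c * √x - m * (√x)⁻¹) -
    Real.exp (c * m) * G (-(c * √x + m * (√x)⁻¹))) / (c * √(2 * Real.pi)) with hF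
  have hF0 := (((tendsto_integral_gaussian_atBot.comp hA0).const_mul (Real.exp (-(c * m)))).sub
    ((tendsto_integral_gaussian_atBot.comp hB0).const_mul (Real.exp (c * m)))).div_const
      (c * √(2 * Real.pi))
  have hF1 := (((tendsto_integral_gaussian_atTop.comp hA1).const_mul (Real.exp (-(c * m)))).sub
    ((tendsto_integral_gaussian_atBot.comp hB1).const_mul (Real.exp (c * m)))).div_const
      (c * √(2 * Real.pi))
  have hFd : ∀ x ∈ Set.Ioi (0 : ℝ), HasDerivAt F ((2 * Real.pi * x) ^ (-(1 : ℝ) / 2) *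
      Real.exp (-m ^ 2 / (2 * x) - c ^ 2 * x / 2)) x := by
    intro x hx
    have hx' : 0 < x := hx
    have hr : 0 < √x := Real.sqrt_pos.2 hx'
    have hsq : √x ^ 2 = x := Real.sq_sqrt hx'.le
    have h₁ := (Real.hasDerivAt_sqrt hx'.ne').const_mul c
    have h₂ := ((Real.hasDerivAt_sqrt hx'.ne').fun_inv hr.ne').const_mul m
    have h := ((((hGd _).comp x (h₁.sub h₂)).const_mul (Real.exp (-(c * m)))).sub
      (((hGd _).comp x (h₁.add h₂).neg).const_mul (Real.exp (c * m)))).div_const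
        (c * √(2 * Real.pi))
    refine h.congr_deriv ?_
    have hE : -m ^ 2 / (2 * x) - c ^ 2 * x / 2 =
        -m ^ 2 / (2 * √x ^ 2) - c ^ 2 * √x ^ 2 / 2 := by rw [hsq]
    have hE₁ : Real.exp (-(c * m)) * Real.exp (-(1 / 2) * (c * √x - m * (√x)⁻¹) ^ 2) =
        Real.exp (-m ^ 2 / (2 * x) - c ^ 2 * x / 2) := by
      rw [← Real.exp_add]
      congr 1
      rw [hE]
      field_simp
      ring
    have hE₂ : Real.exp (c * m) * Real.exp (-(1 / 2) * (-(c * √x + m * (√x)⁻¹)) ^ 2) =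
        Real.exp (-m ^ 2 / (2 * x) - c ^ 2 * x / 2) := by
      rw [← Real.exp_add]
      congr 1
      rw [hE]
      field_simp
      ring
    have hrp : (2 * Real.pi * x) ^ (-(1 : ℝ) / 2) = (√(2 * Real.pi) * √x)⁻¹ := by
      rw [neg_div, Real.rpow_neg (by positivity), ← Real.sqrt_eq_rpow,
        Real.sqrt_mul (by positivity)]
    simp only [Pi.sub_apply, Pi.add_apply, Pi.neg_apply]
    rw [← mul_assoc, ← mul_assoc, hE₁, hE₂, hrp]
    field_simp
    ring
  have key := integrableOn_and_integral_Ioi_of_hasDerivAt_of_tendsto hFd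
    (fun x hx => by have : (0 : ℝ) < x := hx; positivity) hF0 hF1
  refine ⟨key.1, key.2.trans ?_⟩
  field_simp
  ring

theorem logistic_power_pdf_representation_of_ne_zero {a b μ : ℝ} (ha : 0 < a) (hb : 0 < b)
    (hμ : μ ≠ 0) :
    (1 / betaFn a b) * Real.exp (-(a * μ)) * (1 + Real.exp (-μ)) ^ (-(a + b)) =
      ∫ lam in Set.Ioi (0 : ℝ),
        (2 * Real.pi * lam) ^ (-(1 : ℝ) / 2) *
          Real.exp (-(μ + (1 / 2) * (a - b) * lam) ^ 2 / (2 * lam)) * polya a b lam := by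
  have hB := betaFn_pos ha hb
  have hm : 0 < |μ| := abs_pos.2 hμ
  have hδ : ∀ k : ℕ, 0 < (a + b) / 2 + k := fun k => by positivity
  set I : ℕ → ℝ → ℝ := fun k x => (2 * Real.pi * x) ^ (-(1 : ℝ) / 2) *
    Real.exp (-|μ| ^ 2 / (2 * x) - ((a + b) / 2 + k) ^ 2 * x / 2) with hI
  set D : ℝ := Real.exp (-(μ * ((a - b) / 2))) with hD
  set y : ℝ := Real.exp (-|μ|) with hy
  have hy1 : |y| < 1 := by rw [abs_of_pos (Real.exp_pos _)]; simpa [hy] using hμ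
  have hint := fun k : ℕ => integrableOn_and_integral_gaussian_scale_mixture (hδ k) hm
  have hexp : ∀ k : ℕ, Real.exp (-(((a + b) / 2 + k) * |μ|)) =
      Real.exp (-((a + b) / 2 * |μ|)) * y ^ k := fun k => by
    rw [hy, ← Real.exp_nat_mul, ← Real.exp_add]; congr 1; ring
  have hval : ∀ k : ℕ, ∫ x in Set.Ioi (0 : ℝ), polyaWeight a b k * D * I k x =
      D * Real.exp (-((a + b) / 2 * |μ|)) / betaFn a b *
        ((∏ i ∈ Finset.range k, (a + b + i)) / (k.factorial : ℝ) * (-y) ^ k) := fun k => by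
    rw [integral_const_mul, (hint k).2, hexp, polyaWeight, neg_pow y]
    have := (hδ k).ne'
    field_simp
  have hnorm : ∀ k : ℕ, ∫ x in Set.Ioi (0 : ℝ), ‖polyaWeight a b k * D * I k x‖ =
      D * Real.exp (-((a + b) / 2 * |μ|)) / betaFn a b *
        ((∏ i ∈ Finset.range k, (a + b + i)) / (k.factorial : ℝ) * y ^ k) := fun k => by
    have : ∀ x ∈ Set.Ioi (0 : ℝ), ‖polyaWeight a b k * D * I k x‖ =
        ‖polyaWeight a b k‖ * D * I k x := fun x hx => by
      have hx' : (0 : ℝ) < x := hx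
      rw [norm_mul, norm_mul, Real.norm_of_nonneg (Real.exp_pos _).le,
        Real.norm_of_nonneg (by positivity : 0 ≤ I k x)]
    rw [setIntegral_congr_fun measurableSet_Ioi this, integral_const_mul, (hint k).2, hexp,
      norm_polyaWeight ha hb]
    have := (hδ k).ne'
    field_simp
  have hsum := hasSum_integral_of_summable_integral_norm
    (F := fun (k : ℕ) x => polyaWeight a b k * D * I k x) (μ := volume.restrict (Set.Ioi 0))
    (fun k => (hint k).1.const_mul _)
    (by simpa only [hnorm] using
      (hasSum_rising_div_factorial_mul_pow (a + b) hy1).summable.mul_left _)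
  simp only [hval] at hsum
  have hser := (hasSum_rising_div_factorial_mul_pow (a + b) (y := -y)
    (by rwa [abs_neg])).mul_left (D * Real.exp (-((a + b) / 2 * |μ|)) / betaFn a b)
  have hptw : ∀ x ∈ Set.Ioi (0 : ℝ), (2 * Real.pi * x) ^ (-(1 : ℝ) / 2) *
      Real.exp (-(μ + (1 / 2) * (a - b) * x) ^ 2 / (2 * x)) * polya a b x =
        ∑' k : ℕ, polyaWeight a b k * D * I k x := fun x hx => by
    have hx' : x ≠ 0 := ne_of_gt hx
    rw [polya, ← tsum_mul_left]
    refine tsum_congr fun k => ?_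
    have h : Real.exp (-(μ + (1 / 2) * (a - b) * x) ^ 2 / (2 * x)) *
        Real.exp (-((a + k) * (b + k) * x / 2)) =
          D * Real.exp (-|μ| ^ 2 / (2 * x) - ((a + b) / 2 + k) ^ 2 * x / 2) := by
      rw [hD, ← Real.exp_add, ← Real.exp_add, sq_abs]
      congr 1
      field_simp
      ring
    simp only [hI]
    linear_combination ((2 * Real.pi * x) ^ (-(1 : ℝ) / 2) * polyaWeight a b k) * h
  rw [setIntegral_congr_fun measurableSet_Ioi hptw, hsum.unique hser, sub_neg_eq_add,
    Real.rpow_neg (by positivity)]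
  rcases lt_or_gt_of_ne hμ with h | h
  · have h1 : 1 + y = Real.exp μ * (1 + Real.exp (-μ)) := by
      rw [mul_add, ← Real.exp_add, hy, abs_of_neg h]; simp [add_comm]
    have h2 : D * Real.exp (-((a + b) / 2 * |μ|)) = Real.exp (-(a * μ)) * Real.exp (μ * (a + b)) := by
      rw [hD, ← Real.exp_add, ← Real.exp_add, abs_of_neg h]; congr 1; ring
    rw [h1, h2, Real.mul_rpow (Real.exp_pos _).le (by positivity), ← Real.exp_mul]
    have := (Real.exp_pos (μ * (a + b))).ne'
    field_simp
  · have h2 : D * Real.exp (-((a + b) / 2 * |μ|)) = Real.exp (-(a * μ)) := by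
      rw [hD, ← Real.exp_add, abs_of_pos h]; congr 1; ring
    rw [h2, hy, abs_of_pos h]
    field_simp

theorem logistic_power_pdf_representation_zero {a b : ℝ} (ha : 0 < a) (hb : 0 < b) :
    (1 / betaFn a b) * Real.exp (-(a * 0)) * (1 + Real.exp (-0)) ^ (-(a + b)) =
      ∫ lam in Set.Ioi (0 : ℝ),
        (2 * Real.pi * lam) ^ (-(1 : ℝ) / 2) *
          Real.exp (-(0 + (1 / 2) * (a - b) * lam) ^ 2 / (2 * lam)) * polya a b lam := by
  have hB := betaFn_pos ha hb
  set h : ℝ → ℝ := fun x => (2 * Real.pi * x) ^ (-(1 : ℝ) / 2) *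
    Real.exp (-(0 + (1 / 2) * (a - b) * x) ^ 2 / (2 * x)) * polya a b x with hh
  set V : ℝ → ℝ := fun m => (1 / betaFn a b) * Real.exp (-(a * m)) *
    (1 + Real.exp (-m)) ^ (-(a + b)) with hV
  set g : ℕ → ℝ → ℝ := fun n x => Real.exp (-(1 / ((n : ℝ) + 1)) ^ 2 / (2 * x)) * h x with hg
  have hh0 : ∀ x ∈ Set.Ioi (0 : ℝ), 0 ≤ h x := fun x hx => by
    have hx' : (0 : ℝ) < x := hx
    exact mul_nonneg (by positivity) (polya_nonneg ha hb hx)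
  have hg0 : ∀ n, ∀ x ∈ Set.Ioi (0 : ℝ), 0 ≤ g n x := fun n x hx =>
    mul_nonneg (Real.exp_pos _).le (hh0 x hx)
  have hgint : ∀ n : ℕ, ∫ x in Set.Ioi (0 : ℝ), g n x =
      Real.exp (1 / ((n : ℝ) + 1) * ((a - b) / 2)) * V (1 / ((n : ℝ) + 1)) := fun n => by
    have hm : 1 / ((n : ℝ) + 1) ≠ 0 := by positivity
    rw [hV]
    simp only
    rw [logistic_power_pdf_representation_of_ne_zero ha hb hm, ← integral_const_mul]
    refine setIntegral_congr_fun measurableSet_Ioi fun x hx => ?_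
    have hx' : x ≠ 0 := ne_of_gt hx
    have he : Real.exp (-(1 / ((n : ℝ) + 1)) ^ 2 / (2 * x)) *
        Real.exp (-(0 + (1 / 2) * (a - b) * x) ^ 2 / (2 * x)) =
          Real.exp (1 / ((n : ℝ) + 1) * ((a - b) / 2)) *
            Real.exp (-(1 / ((n : ℝ) + 1) + (1 / 2) * (a - b) * x) ^ 2 / (2 * x)) := by
      rw [← Real.exp_add, ← Real.exp_add]
      congr 1
      field_simp
      ring
    simp only [hg, hh]
    linear_combination ((2 * Real.pi * x) ^ (-(1 : ℝ) / 2) * polya a b x) * he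
  have hgI : ∀ n, Integrable (g n) (volume.restrict (Set.Ioi 0)) := fun n =>
    Integrable.of_integral_ne_zero <| by
      rw [hgint]
      exact (by positivity : 0 < Real.exp (1 / ((n : ℝ) + 1) * ((a - b) / 2)) *
        V (1 / ((n : ℝ) + 1))).ne'
  have hmono : ∀ x ∈ Set.Ioi (0 : ℝ), Monotone fun n => g n x := fun x hx n n' hn => by
    have hx' : (0 : ℝ) < x := hx
    refine mul_le_mul_of_nonneg_right (Real.exp_le_exp.2 ?_) (hh0 x hx)
    have : (n : ℝ) ≤ n' := by exact_mod_cast hn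
    gcongr
  have hlim0 : Tendsto (fun n : ℕ => 1 / ((n : ℝ) + 1)) atTop (𝓝 0) :=
    tendsto_one_div_add_atTop_nhds_zero_nat
  have hlim : ∀ x ∈ Set.Ioi (0 : ℝ), Tendsto (fun n => g n x) atTop (𝓝 (h x)) := fun x _ => by
    have hc : Continuous fun m : ℝ => Real.exp (-m ^ 2 / (2 * x)) * h x := by fun_prop
    have h0 : Real.exp (-(0 : ℝ) ^ 2 / (2 * x)) * h x = h x := by simp
    exact h0 ▸ (hc.tendsto 0).comp hlim0
  have hmeas : AEStronglyMeasurable h (volume.restrict (Set.Ioi 0)) :=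
    aestronglyMeasurable_of_tendsto_ae atTop (fun n => (hgI n).aestronglyMeasurable)
      ((ae_restrict_iff' measurableSet_Ioi).2 (ae_of_all _ hlim))
  have hL := lintegral_tendsto_of_tendsto_of_monotone (μ := volume.restrict (Set.Ioi 0))
    (f := fun n x => ENNReal.ofReal (g n x)) (F := fun x => ENNReal.ofReal (h x))
    (fun n => (hgI n).aestronglyMeasurable.aemeasurable.ennreal_ofReal)
    ((ae_restrict_iff' measurableSet_Ioi).2 (ae_of_all _ fun x hx n n' hn =>
      ENNReal.ofReal_le_ofReal (hmono x hx hn)))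
    ((ae_restrict_iff' measurableSet_Ioi).2 (ae_of_all _ fun x hx =>
      (ENNReal.continuous_ofReal.tendsto _).comp (hlim x hx)))
  have hVc : Continuous fun m : ℝ => Real.exp (m * ((a - b) / 2)) * V m := by
    refine Continuous.mul (by fun_prop) (Continuous.mul (by fun_prop) ?_)
    exact (by fun_prop : Continuous fun m : ℝ => 1 + Real.exp (-m)).rpow_const
      fun m => Or.inl (by positivity)
  have hR : Tendsto (fun n => ∫⁻ x in Set.Ioi 0, ENNReal.ofReal (g n x)) atTop
      (𝓝 (ENNReal.ofReal (V 0))) := by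
    have := (ENNReal.continuous_ofReal.tendsto _).comp ((hVc.tendsto 0).comp hlim0)
    rw [zero_mul, Real.exp_zero, one_mul] at this
    refine this.congr fun n => ?_
    rw [← ofReal_integral_eq_lintegral_ofReal (hgI n)
      ((ae_restrict_iff' measurableSet_Ioi).2 (ae_of_all _ (hg0 n))), hgint]
    rfl
  rw [integral_eq_lintegral_of_nonneg_ae
    ((ae_restrict_iff' measurableSet_Ioi).2 (ae_of_all _ hh0)) hmeas,
    tendsto_nhds_unique hL hR, ENNReal.toReal_ofReal (by positivity)]

/-- The pdf representation of the powered logistic likelihood: for `a, b > 0` with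
`a + b = κ` and `μ ∈ ℝ`,
`(1/B(a,b)) e^{-aμ} (1+e^{-μ})^{-κ} = ∫_0^∞ (2πλ)^{-1/2} exp(-(μ + (1/2)(a-b)λ)²/(2λ)) q_{a,b}(λ) dλ`,
equivalently `(1+e^{-μ})^{-κ} = B(a,b) e^{aμ} ∫_0^∞ ⋯ dλ`. -/
theorem logistic_power_pdf_representation (a b κ μ : ℝ) (ha : 0 < a) (hb : 0 < b)
    (hab : a + b = κ) :
    (1 / betaFn a b) * Real.exp (-(a * μ)) * (1 + Real.exp (-μ)) ^ (-κ) =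
      (∫ lam in Set.Ioi (0 : ℝ),
        (2 * Real.pi * lam) ^ (-(1 : ℝ) / 2) *
          Real.exp (-(μ + (1 / 2) * (a - b) * lam) ^ 2 / (2 * lam)) * polya a b lam) ∧
    (1 + Real.exp (-μ)) ^ (-κ) =
      betaFn a b * Real.exp (a * μ) *
        ∫ lam in Set.Ioi (0 : ℝ),
          (2 * Real.pi * lam) ^ (-(1 : ℝ) / 2) *
            Real.exp (-(μ + (1 / 2) * (a - b) * lam) ^ 2 / (2 * lam)) * polya a b lam := by
  subst hab
  have key : (1 / betaFn a b) * Real.exp (-(a * μ)) * (1 + Real.exp (-μ)) ^ (-(a + b)) =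
      ∫ lam in Set.Ioi (0 : ℝ),
        (2 * Real.pi * lam) ^ (-(1 : ℝ) / 2) *
          Real.exp (-(μ + (1 / 2) * (a - b) * lam) ^ 2 / (2 * lam)) * polya a b lam := by
    rcases eq_or_ne μ 0 with rfl | hμ
    · exact logistic_power_pdf_representation_zero ha hb
    · exact logistic_power_pdf_representation_of_ne_zero ha hb hμ
  refine ⟨key, ?_⟩
  have hB := (betaFn_pos ha hb).ne'
  rw [← key, Real.exp_neg (a * μ)]
  field_simp
end

section
/- Let v > 0 and β ∈ ℝ. Then ∫_0^∞ (2πωv)^{-1/2} · exp( −β² / (2ωv) ) · (1/2) e^{−ω/2} dω = (1/(2√v)) · e^{−|β|/√v}. In particular, taking v = ν²σ²/κ² with ν, σ, κ > 0, if β given ω is normal with mean 0 and variance ω·ν²σ²/κ² and ω has the exponential density (1/2)e^{−ω/2} on (0,∞), then the marginal density of β is the double-exponential (Laplace) density (κ/(2νσ)) e^{−κ|β|/(νσ)}. -/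
open MeasureTheory Set in
/-- A Cauchy–Schlömilch type substitution for the half-line Gaussian integral. -/
lemma integral_exp_neg_sub_div_sq_Ioi {b : ℝ} (hb : 0 ≤ b) :
    ∫ t in Ioi (0 : ℝ), Real.exp (-(1 / 2) * (t - b / t) ^ 2) = Real.sqrt (2 * Real.pi) / 2 := by
  have hpi : Real.pi / (1 / 2) = 2 * Real.pi := by ring
  rcases hb.eq_or_lt with rfl | hb
  · simp only [zero_div, sub_zero]
    rw [integral_gaussian_Ioi, hpi]
  have hrad : ∀ u : ℝ, 0 < u ^ 2 + 4 * b := fun u ↦ by positivity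
  have hs : ∀ u : ℝ, Real.sqrt (u ^ 2 + 4 * b) ^ 2 = u ^ 2 + 4 * b :=
    fun u ↦ Real.sq_sqrt (hrad u).le
  have hlt : ∀ u : ℝ, |u| < Real.sqrt (u ^ 2 + 4 * b) := fun u ↦ by
    rw [← Real.sqrt_sq_eq_abs]
    exact Real.sqrt_lt_sqrt (sq_nonneg u) (by linarith)
  set φ : ℝ → ℝ := fun u ↦ (u + Real.sqrt (u ^ 2 + 4 * b)) / 2 with hφ
  set φ' : ℝ → ℝ := fun u ↦ (1 + u / Real.sqrt (u ^ 2 + 4 * b)) / 2 with hφ'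
  have hpos : ∀ u, 0 < φ u := fun u ↦ by
    have := (abs_lt.1 (hlt u)).1
    simp only [hφ]; linarith
  have hinv : ∀ u, φ u - b / φ u = u := fun u ↦ by
    have h := hpos u
    field_simp
    simp only [hφ]
    nlinarith [hs u]
  have hinj : Function.Injective φ := Function.LeftInverse.injective (g := fun t ↦ t - b / t) hinv
  have himage : φ '' univ = Ioi 0 := by
    ext t
    simp only [image_univ, mem_range, mem_Ioi]
    refine ⟨fun ⟨u, hu⟩ ↦ hu ▸ hpos u, fun ht ↦ ⟨t - b / t, ?_⟩⟩
    have : (t - b / t) ^ 2 + 4 * b = (t + b / t) ^ 2 := by field_simp; ring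
    simp only [hφ]
    rw [this, Real.sqrt_sq (by positivity)]
    ring
  have hderiv : ∀ u ∈ (univ : Set ℝ), HasDerivWithinAt φ (φ' u) univ u := fun u _ ↦ by
    have h := ((hasDerivAt_id u).add
      ((((hasDerivAt_id u).pow 2).add_const (4 * b)).sqrt (hrad u).ne')).div_const 2
    refine (h.congr_deriv ?_).hasDerivWithinAt
    have := Real.sqrt_pos.2 (hrad u)
    simp only [hφ', id, Pi.pow_apply, Nat.cast_ofNat]
    field_simp
    ring
  have hratio : ∀ u : ℝ, |u / Real.sqrt (u ^ 2 + 4 * b)| ≤ 1 := fun u ↦ by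
    rw [abs_div, abs_of_nonneg (Real.sqrt_nonneg _)]
    exact div_le_one_of_le₀ (hlt u).le (Real.sqrt_nonneg _)
  have hφ'_nonneg : ∀ u, 0 ≤ φ' u := fun u ↦ by
    have := (abs_le.1 (hratio u)).1
    simp only [hφ']; linarith
  have hφ'_add_neg : ∀ u, φ' u + φ' (-u) = 1 := fun u ↦ by
    simp only [hφ', neg_sq]; ring
  rw [← himage, integral_image_eq_integral_abs_deriv_smul MeasurableSet.univ hderiv hinj.injOn]
  simp only [hinv, abs_of_nonneg (hφ'_nonneg _), smul_eq_mul, Measure.restrict_univ]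
  set f : ℝ → ℝ := fun u ↦ φ' u * Real.exp (-(1 / 2) * u ^ 2) with hf
  have hf_int : Integrable f := by
    refine (integrable_exp_neg_mul_sq (b := 1 / 2) (by norm_num)).mono' ?_ ?_
    · have : Measurable f := by fun_prop
      exact this.aestronglyMeasurable
    · refine Filter.Eventually.of_forall fun u ↦ ?_
      simp only [hf, Real.norm_eq_abs]
      rw [abs_of_nonneg (mul_nonneg (hφ'_nonneg u) (Real.exp_pos _).le)]
      refine mul_le_of_le_one_left (Real.exp_pos _).le ?_
      linarith [hφ'_add_neg u, hφ'_nonneg (-u)]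
  have hsum : (∫ u, f u) + ∫ u, f (-u) = Real.sqrt (2 * Real.pi) := by
    rw [← integral_add hf_int hf_int.comp_neg, ← hpi, ← integral_gaussian]
    congr 1 with u
    simp only [hf, neg_sq]
    rw [← add_mul, hφ'_add_neg, one_mul]
  rw [integral_neg_eq_self] at hsum
  linarith

open MeasureTheory Set in
/-- The Laplace density as an exponential scale mixture of centred normal densities. -/
lemma integral_normal_mul_exp_Ioi {v : ℝ} (hv : 0 < v) (β : ℝ) :
    (∫ ω in Ioi (0 : ℝ),
        (2 * Real.pi * ω * v) ^ (-(1 : ℝ) / 2) * Real.exp (-β ^ 2 / (2 * ω * v)) *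
          ((1 / 2) * Real.exp (-ω / 2))) =
      (1 / (2 * Real.sqrt v)) * Real.exp (-|β| / Real.sqrt v) := by
  have hsv := Real.sqrt_pos.2 hv
  have hspi : 0 < Real.sqrt (2 * Real.pi) := Real.sqrt_pos.2 (by positivity)
  set b := |β| / Real.sqrt v with hb
  rw [← integral_comp_rpow_Ioi_of_pos (p := 2) two_pos]
  have hcongr : ∀ t ∈ Ioi (0 : ℝ),
      (2 * t ^ ((2 : ℝ) - 1)) • ((2 * Real.pi * t ^ (2 : ℝ) * v) ^ (-(1 : ℝ) / 2) *
        Real.exp (-β ^ 2 / (2 * t ^ (2 : ℝ) * v)) * ((1 / 2) * Real.exp (-t ^ (2 : ℝ) / 2))) =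
      (Real.exp (-b) / (Real.sqrt (2 * Real.pi) * Real.sqrt v)) *
        Real.exp (-(1 / 2) * (t - b / t) ^ 2) := fun t ht ↦ by
    rw [mem_Ioi] at ht
    have hexp : Real.exp (-b) * Real.exp (-(1 / 2) * (t - b / t) ^ 2) =
        Real.exp (-β ^ 2 / (2 * t ^ 2 * v)) * Real.exp (-t ^ 2 / 2) := by
      rw [← Real.exp_add, ← Real.exp_add]
      congr 1
      have hb2 : b ^ 2 * v = β ^ 2 := by
        rw [hb, div_pow, sq_abs, Real.sq_sqrt hv.le, div_mul_cancel₀ _ hv.ne']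
      rw [← hb2]
      field_simp
      ring
    have hroot : (2 * Real.pi * t ^ 2 * v) ^ (-(1 : ℝ) / 2) =
        (Real.sqrt (2 * Real.pi) * t * Real.sqrt v)⁻¹ := by
      rw [neg_div, Real.rpow_neg (by positivity), ← Real.sqrt_eq_rpow,
        Real.sqrt_mul (by positivity), Real.sqrt_mul (by positivity), Real.sqrt_sq ht.le]
    rw [show (2 : ℝ) - 1 = 1 by norm_num, Real.rpow_one, Real.rpow_two, hroot, smul_eq_mul,
      div_mul_eq_mul_div (Real.exp (-b)), hexp]
    field_simp
  rw [setIntegral_congr_fun measurableSet_Ioi hcongr, integral_const_mul,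
    integral_exp_neg_sub_div_sq_Ioi (by positivity), neg_div, ← hb]
  field_simp

/-- Scale mixture of normals representation of the Laplace (double-exponential)
density: for `v > 0`,
`∫_0^∞ (2πωv)^{-1/2} exp(-β²/(2ωv)) (1/2)e^{-ω/2} dω = (1/(2√v)) e^{-|β|/√v}`.
In particular, with `v = ν²σ²/κ²`, if `β | ω ~ N(0, ω ν²σ²/κ²)` and
`ω ~ Exp(2)`, then the marginal density of `β` is the Laplace density
`(κ/(2νσ)) e^{-κ|β|/(νσ)}`. -/
theorem laplace_scale_mixture (v β : ℝ) (hv : 0 < v)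
    (ν σ κ : ℝ) (hν : 0 < ν) (hσ : 0 < σ) (hκ : 0 < κ) :
    (∫ ω in Set.Ioi (0 : ℝ),
        (2 * Real.pi * ω * v) ^ (-(1 : ℝ) / 2) * Real.exp (-β ^ 2 / (2 * ω * v)) *
          ((1 / 2) * Real.exp (-ω / 2))) =
      (1 / (2 * Real.sqrt v)) * Real.exp (-|β| / Real.sqrt v) ∧
    (∫ ω in Set.Ioi (0 : ℝ),
        (2 * Real.pi * ω * (ν ^ 2 * σ ^ 2 / κ ^ 2)) ^ (-(1 : ℝ) / 2) *
          Real.exp (-β ^ 2 / (2 * ω * (ν ^ 2 * σ ^ 2 / κ ^ 2))) *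
          ((1 / 2) * Real.exp (-ω / 2))) =
      (κ / (2 * ν * σ)) * Real.exp (-κ * |β| / (ν * σ)) := by
  refine ⟨integral_normal_mul_exp_Ioi hv β, ?_⟩
  have hsqrt : Real.sqrt (ν ^ 2 * σ ^ 2 / κ ^ 2) = ν * σ / κ := by
    rw [← mul_pow, ← div_pow, Real.sqrt_sq (by positivity)]
  rw [integral_normal_mul_exp_Ioi (by positivity), hsqrt]
  have harg : -|β| / (ν * σ / κ) = -κ * |β| / (ν * σ) := by
    field_simp
  rw [harg]
  field_simp
end

section
/- Let κ, ν, σ > 0 and β ∈ ℝ with β ≠ 0, and set c = κ²β²/(ν²σ²). Suppose ω is a positive random variable whose density on (0,∞) is proportional to ω ↦ (2πω)^{-1/2} · exp( −(1/2)( c/ω + ω ) ). Then ω^{-1} follows the inverse Gaussian distribution with mean parameter μ = (ν/κ)·|β/σ|^{-1} = νσ/(κ|β|) and shape parameter 1; that is, the pushforward of the law of ω under x ↦ 1/x has density y ↦ √(1/(2πy³)) · exp( −(y − μ)² / (2μ² y) ) on (0,∞). (This is the paper's Corollary on the full conditional of ω_j in the α = 1 lasso case.) -/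
open MeasureTheory

theorem lintegral_Ioi_eq_lintegral_comp_div {b : ℝ} (hb : 0 < b) (f : ℝ → ENNReal) :
    ∫⁻ x in Set.Ioi 0, f x = ∫⁻ x in Set.Ioi 0, ENNReal.ofReal (b / x ^ 2) * f (b / x) := by
  have himage : (fun x : ℝ => b / x) '' Set.Ioi 0 = Set.Ioi 0 := by
    ext y
    simp only [Set.mem_image, Set.mem_Ioi]
    refine ⟨?_, fun hy => ⟨b / y, by positivity, by field_simp⟩⟩
    rintro ⟨x, hx, rfl⟩
    positivity
  have hderiv : ∀ x ∈ Set.Ioi (0 : ℝ),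
      HasDerivWithinAt (fun x : ℝ => b / x) (-(b / x ^ 2)) (Set.Ioi 0) x := by
    intro x hx
    simpa [div_eq_mul_inv] using
      ((hasDerivAt_inv (ne_of_gt hx)).const_mul b).hasDerivWithinAt (s := Set.Ioi 0)
  have hinj : Set.InjOn (fun x : ℝ => b / x) (Set.Ioi 0) := by
    intro x hx y hy hxy
    have hx' : 0 < x := hx
    have hy' : 0 < y := hy
    simp only at hxy
    field_simp at hxy
    exact hxy.symm
  conv_lhs => rw [← himage]
  rw [lintegral_image_eq_lintegral_abs_deriv_mul measurableSet_Ioi hderiv hinj]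
  refine setLIntegral_congr_fun measurableSet_Ioi fun x _ => ?_
  simp only [abs_neg]
  rw [abs_of_nonneg (by positivity)]

theorem hasDerivAt_sub_div_sqrt (a : ℝ) {x : ℝ} (hx : 0 < x) :
    HasDerivAt (fun x => (x - a) / √x) ((x + a) / (2 * (x * √x))) x := by
  have hs : 0 < √x := Real.sqrt_pos.2 hx
  have h := ((hasDerivAt_id x).sub_const a).div (Real.hasDerivAt_sqrt hx.ne') hs.ne'
  refine h.congr_deriv ?_
  simp only [id_eq]
  field_simp
  rw [Real.sq_sqrt hx.le]
  ring

theorem strictMonoOn_sub_div_sqrt {a : ℝ} (ha : 0 < a) :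
    StrictMonoOn (fun x => (x - a) / √x) (Set.Ioi 0) := by
  intro x hx y hy hxy
  have hx' : 0 < x := hx
  have hy' : 0 < y := hy
  have hsx : 0 < √x := Real.sqrt_pos.2 hx'
  have hsxy : √x < √y := Real.sqrt_lt_sqrt hx'.le hxy
  have hsplit : ∀ z : ℝ, 0 < z → (z - a) / √z = √z - a / √z := by
    intro z hz
    rw [sub_div, Real.div_sqrt]
  simp only [hsplit x hx', hsplit y hy']
  have : a / √y < a / √x := by gcongr
  linarith

theorem image_sub_div_sqrt_Ioi {a : ℝ} (ha : 0 < a) :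
    (fun x => (x - a) / √x) '' Set.Ioi 0 = Set.univ := by
  refine Set.eq_univ_of_forall fun u => ?_
  have hroot : |u| < √(u ^ 2 + 4 * a) := by
    rw [← Real.sqrt_sq_eq_abs]
    exact Real.sqrt_lt_sqrt (sq_nonneg u) (by linarith)
  have hsq : √(u ^ 2 + 4 * a) ^ 2 = u ^ 2 + 4 * a := Real.sq_sqrt (by positivity)
  have ht : 0 < (u + √(u ^ 2 + 4 * a)) / 2 := by linarith [neg_abs_le u]
  refine ⟨((u + √(u ^ 2 + 4 * a)) / 2) ^ 2, pow_pos ht 2, ?_⟩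
  simp only [Real.sqrt_sq ht.le]
  rw [div_eq_iff ht.ne']
  linarith

theorem lintegral_inv_sqrt_mul_gaussianPDFReal {a : ℝ} (ha : 0 < a) :
    ∫⁻ x in Set.Ioi 0, ENNReal.ofReal
      ((√x)⁻¹ * ProbabilityTheory.gaussianPDFReal 0 1 ((x - a) / √x)) = 1 := by
  set g := ProbabilityTheory.gaussianPDFReal 0 1 with hg
  have hg_even : ∀ u, g (-u) = g u := by simp [hg, ProbabilityTheory.gaussianPDFReal]
  have hg_nonneg : ∀ u, 0 ≤ g u := ProbabilityTheory.gaussianPDFReal_nonneg 0 1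
  have hg_meas : Measurable g := ProbabilityTheory.measurable_gaussianPDFReal 0 1
  have htotal := ProbabilityTheory.lintegral_gaussianPDFReal_eq_one 0 one_ne_zero
  rw [← hg, ← setLIntegral_univ, ← image_sub_div_sqrt_Ioi ha,
    lintegral_image_eq_lintegral_abs_deriv_mul measurableSet_Ioi
      (fun x hx => (hasDerivAt_sub_div_sqrt a hx).hasDerivWithinAt)
      (strictMonoOn_sub_div_sqrt ha).injOn] at htotal
  have hsymm : ∫⁻ x in Set.Ioi 0, ENNReal.ofReal ((√x)⁻¹ * g ((x - a) / √x)) =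
      ∫⁻ x in Set.Ioi 0, ENNReal.ofReal (a / (x * √x) * g ((x - a) / √x)) := by
    rw [lintegral_Ioi_eq_lintegral_comp_div (pow_pos ha 2)]
    refine setLIntegral_congr_fun measurableSet_Ioi fun x hx => ?_
    have hx' : 0 < x := hx
    have hs : 0 < √x := Real.sqrt_pos.2 hx'
    have harg : (a ^ 2 / x - a) / √(a ^ 2 / x) = -((x - a) / √x) := by
      rw [Real.sqrt_div (sq_nonneg a), Real.sqrt_sq ha.le]
      field_simp
      rw [Real.sq_sqrt hx'.le]
      ring
    have hcoef : a ^ 2 / x ^ 2 * (√(a ^ 2 / x))⁻¹ = a / (x * √x) := by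
      rw [Real.sqrt_div (sq_nonneg a), Real.sqrt_sq ha.le]
      field_simp
      rw [Real.sq_sqrt hx'.le]
    simp only [harg, hg_even]
    rw [← ENNReal.ofReal_mul (by positivity), ← mul_assoc, hcoef]
  rw [← htotal, ← ENNReal.mul_right_inj two_ne_zero ENNReal.ofNat_ne_top, two_mul]
  nth_rw 2 [hsymm]
  rw [← lintegral_add_left (by fun_prop), ← lintegral_const_mul _ (by fun_prop)]
  refine setLIntegral_congr_fun measurableSet_Ioi fun x hx => ?_
  have hx' : 0 < x := hx
  have hs : 0 < √x := Real.sqrt_pos.2 hx'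
  have hgx := hg_nonneg ((x - a) / √x)
  rw [abs_of_nonneg (by positivity), ← ENNReal.ofReal_add (by positivity) (by positivity),
    ← ENNReal.ofReal_mul (by positivity), ← ENNReal.ofReal_ofNat,
    ← ENNReal.ofReal_mul (by norm_num)]
  congr 1
  field_simp

theorem rpow_mul_exp_eq_exp_mul_gaussianPDFReal (a : ℝ) {x : ℝ} (hx : 0 < x) :
    (2 * Real.pi * x) ^ (-(1 : ℝ) / 2) * Real.exp (-(1 / 2) * (a ^ 2 / x + x)) =
      Real.exp (-a) * ((√x)⁻¹ * ProbabilityTheory.gaussianPDFReal 0 1 ((x - a) / √x)) := by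
  have hexp : -(1 / 2) * (a ^ 2 / x + x) = -a + -((x - a) / √x) ^ 2 / 2 := by
    rw [div_pow, Real.sq_sqrt hx.le]
    field_simp
    ring
  rw [neg_div, Real.rpow_neg (by positivity), ← Real.sqrt_eq_rpow,
    Real.sqrt_mul (by positivity), hexp, Real.exp_add]
  simp only [ProbabilityTheory.gaussianPDFReal, NNReal.coe_one, mul_one, sub_zero, mul_inv]
  ring

theorem inv_sq_mul_rpow_mul_exp_comp_inv {m : ℝ} (hm : 0 < m) {y : ℝ} (hy : 0 < y) :
    1 / y ^ 2 * (Real.exp m⁻¹ * ((2 * Real.pi * (1 / y)) ^ (-(1 : ℝ) / 2) *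
        Real.exp (-(1 / 2) * (m⁻¹ ^ 2 / (1 / y) + 1 / y)))) =
      √(1 / (2 * Real.pi * y ^ 3)) * Real.exp (-(y - m) ^ 2 / (2 * m ^ 2 * y)) := by
  have hexp : -(y - m) ^ 2 / (2 * m ^ 2 * y) =
      m⁻¹ + -(1 / 2) * (m⁻¹ ^ 2 / (1 / y) + 1 / y) := by
    field_simp
    ring
  have hsqrt : √(1 / (2 * Real.pi * y ^ 3)) = 1 / y ^ 2 * (√(2 * Real.pi * (1 / y)))⁻¹ := by
    rw [← Real.sqrt_sq (by positivity : 0 ≤ 1 / y ^ 2 * (√(2 * Real.pi * (1 / y)))⁻¹), mul_pow,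
      inv_pow, Real.sq_sqrt (by positivity)]
    congr 1
    field_simp
  rw [neg_div, Real.rpow_neg (by positivity), ← Real.sqrt_eq_rpow, hexp, Real.exp_add, hsqrt]
  ring

/-- Full conditional of `ω_j` in the `α = 1` (lasso) case: if `ω` is a positive
random variable with density on `(0,∞)` proportional to
`ω ↦ (2πω)^{-1/2} exp(-(1/2)(c/ω + ω))` where `c = κ²β²/(ν²σ²)`, then `ω⁻¹`
follows the inverse Gaussian distribution with mean `μ = νσ/(κ|β|)` and shape `1`. -/
theorem omega_full_conditional (κ ν σ β : ℝ) (hκ : 0 < κ) (hν : 0 < ν) (hσ : 0 < σ)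
    (hβ : β ≠ 0) (c : ℝ) (hc : c = κ ^ 2 * β ^ 2 / (ν ^ 2 * σ ^ 2))
    (P : Measure ℝ) [IsProbabilityMeasure P] (C : ℝ) (hC : 0 < C)
    (hdens : P = (volume.restrict (Set.Ioi 0)).withDensity
      (fun ω => ENNReal.ofReal (C * ((2 * Real.pi * ω) ^ (-(1 : ℝ) / 2) *
        Real.exp (-(1 / 2) * (c / ω + ω)))))) :
    P.map (fun x => x⁻¹) =
      (volume.restrict (Set.Ioi 0)).withDensity
        (fun y => ENNReal.ofReal (Real.sqrt (1 / (2 * Real.pi * y ^ 3)) *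
          Real.exp (-(y - ν * σ / (κ * |β|)) ^ 2 /
            (2 * (ν * σ / (κ * |β|)) ^ 2 * y)))) := by
  set m := ν * σ / (κ * |β|) with hm
  have hβ' : 0 < |β| := abs_pos.2 hβ
  have hm_pos : 0 < m := by positivity
  have hcm : c = m⁻¹ ^ 2 := by
    rw [hc, hm, inv_div, div_pow, mul_pow, mul_pow, sq_abs]
  subst hcm
  have hC_eq : C = Real.exp m⁻¹ := by
    have hmass := measure_univ (μ := P)
    rw [hdens, withDensity_apply _ MeasurableSet.univ, Measure.restrict_univ,
      setLIntegral_congr_fun (g := fun x => ENNReal.ofReal (C * Real.exp (-m⁻¹)) *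
        ENNReal.ofReal ((√x)⁻¹ *
          ProbabilityTheory.gaussianPDFReal 0 1 ((x - m⁻¹) / √x))) measurableSet_Ioi
        (fun x hx => by
          simp only
          rw [rpow_mul_exp_eq_exp_mul_gaussianPDFReal _ hx, ← mul_assoc,
            ENNReal.ofReal_mul (by positivity)]),
      lintegral_const_mul' _ _ ENNReal.ofReal_ne_top,
      lintegral_inv_sqrt_mul_gaussianPDFReal (inv_pos.2 hm_pos), mul_one,
      ENNReal.ofReal_eq_one, Real.exp_neg, mul_inv_eq_one₀ (Real.exp_ne_zero _)] at hmass
    exact hmass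
  subst hC_eq
  rw [hdens]
  refine Measure.ext_of_lintegral _ fun f hf => ?_
  rw [lintegral_map hf measurable_inv,
    lintegral_withDensity_eq_lintegral_mul _ (by fun_prop) (by fun_prop),
    lintegral_withDensity_eq_lintegral_mul _ (by fun_prop) hf,
    lintegral_Ioi_eq_lintegral_comp_div one_pos]
  refine setLIntegral_congr_fun measurableSet_Ioi fun y hy => ?_
  have hy' : 0 < y := hy
  simp only [Pi.mul_apply]
  rw [← mul_assoc, ← ENNReal.ofReal_mul (by positivity),
    inv_sq_mul_rpow_mul_exp_comp_inv hm_pos hy', one_div y, inv_inv]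
end

section
/- Let X be a real n × p matrix, y ∈ ℝ^n, λ ∈ ℝ^n with λ_i > 0 for all i, Λ = diag(λ_1, …, λ_n), let P be a symmetric positive definite p × p real matrix, and let a, b ∈ ℝ. Set A = diag(y)·X, V^{-1} = AᵀΛ^{-1}A + P (which is positive definite, hence invertible), and β̃ = (a − (a−b)/2) · V Xᵀ y. Then for all β ∈ ℝ^p, a·yᵀXβ − (1/2)·(Aβ + (1/2)(a−b)λ)ᵀ Λ^{-1} (Aβ + (1/2)(a−b)λ) − (1/2)·βᵀPβ = −(1/2)·(β − β̃)ᵀ V^{-1} (β − β̃) + c, where c = (1/2)β̃ᵀV^{-1}β̃ − ((a−b)²/8)·λᵀΛ^{-1}λ does not depend on β. In particular, in the pdf representation the full conditional of β is multivariate normal N_p(β̃, V) with β̃ = (a − (1/2)(a−b)) V Xᵀ y, using the identity AᵀΛ^{-1}λ = Xᵀ y. -/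
open Matrix

/-- Completing the square for a symmetric bilinear form. -/
theorem dotProduct_mulVec_complete_square {m : Type*} [Fintype m] {M : Matrix m m ℝ}
    (hM : M.IsSymm) (u v : m → ℝ) :
    u ⬝ᵥ M.mulVec v - (1 / 2) * (u ⬝ᵥ M.mulVec u) =
      -(1 / 2) * ((u - v) ⬝ᵥ M.mulVec (u - v)) + (1 / 2) * (v ⬝ᵥ M.mulVec v) := by
  have hsymm : v ⬝ᵥ M.mulVec u = u ⬝ᵥ M.mulVec v := by
    rw [dotProduct_mulVec, ← mulVec_transpose, hM.eq, dotProduct_comm]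
  simp only [mulVec_sub, dotProduct_sub, sub_dotProduct, hsymm]
  ring

/-- Expansion of a symmetric quadratic form along an affine map. -/
theorem dotProduct_mulVec_mulVec_add_smul {m k : Type*} [Fintype m] [Fintype k]
    {D : Matrix m m ℝ} (hD : D.IsSymm) (A : Matrix m k ℝ) (u : k → ℝ) (v : m → ℝ) (t : ℝ) :
    (A.mulVec u + t • v) ⬝ᵥ D.mulVec (A.mulVec u + t • v) =
      u ⬝ᵥ (Aᵀ * D * A).mulVec u + 2 * t * (u ⬝ᵥ Aᵀ.mulVec (D.mulVec v)) +
        t ^ 2 * (v ⬝ᵥ D.mulVec v) := by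
  have hadj (w : m → ℝ) : u ⬝ᵥ Aᵀ.mulVec w = A.mulVec u ⬝ᵥ w := by
    rw [dotProduct_mulVec, vecMul_transpose]
  have hsymm : v ⬝ᵥ D.mulVec (A.mulVec u) = A.mulVec u ⬝ᵥ D.mulVec v := by
    rw [dotProduct_mulVec, ← mulVec_transpose, hD.eq, dotProduct_comm]
  simp only [← mulVec_mulVec, hadj, mulVec_add, mulVec_smul, dotProduct_add, add_dotProduct,
    smul_dotProduct, dotProduct_smul, smul_eq_mul, hsymm]
  ring

/-- The weights cancel: `AᵀΛ⁻¹λ = Xᵀy` for `A = diag(y)X`. -/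
theorem transpose_diagonal_mul_mulVec_inv_mulVec {m k : Type*} [Fintype m] [DecidableEq m]
    (X : Matrix m k ℝ) (y : m → ℝ) {lam : m → ℝ} (hlam : ∀ i, lam i ≠ 0) :
    (diagonal y * X)ᵀ.mulVec ((diagonal fun i => (lam i)⁻¹).mulVec lam) = Xᵀ.mulVec y := by
  rw [transpose_mul, diagonal_transpose, ← mulVec_mulVec]
  congr 1
  ext i
  simp [mulVec_diagonal, hlam i]

/-- Completing the square for the full conditional of `β` in the pdf
representation: with `A = diag(y)X`, `V⁻¹ = AᵀΛ⁻¹A + P` (positive definite, hence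
invertible) and `β̃ = (a - (a-b)/2) V Xᵀy`, the log full conditional is, up to a
constant not depending on `β`, the quadratic form `-(1/2)(β - β̃)ᵀV⁻¹(β - β̃)`;
so the full conditional of `β` is `N_p(β̃, V)`. -/
theorem beta_full_conditional_pdf (n p : ℕ) (X : Matrix (Fin n) (Fin p) ℝ)
    (y lam : Fin n → ℝ) (hlam : ∀ i, 0 < lam i)
    (P : Matrix (Fin p) (Fin p) ℝ) (hP : P.PosDef) (a b : ℝ) :
    let A := Matrix.diagonal y * X
    let Λinv := Matrix.diagonal (fun i => (lam i)⁻¹)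
    let Vinv := Aᵀ * Λinv * A + P
    let V := Vinv⁻¹
    let βt := (a - (a - b) / 2) • V.mulVec (Xᵀ.mulVec y)
    let c := (1 / 2) * (βt ⬝ᵥ Vinv.mulVec βt) -
      ((a - b) ^ 2 / 8) * (lam ⬝ᵥ Λinv.mulVec lam)
    Vinv.PosDef ∧
      ∀ β : Fin p → ℝ,
        a * (y ⬝ᵥ X.mulVec β) -
            (1 / 2) * ((A.mulVec β + ((1 / 2) * (a - b)) • lam) ⬝ᵥ
              Λinv.mulVec (A.mulVec β + ((1 / 2) * (a - b)) • lam)) -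
            (1 / 2) * (β ⬝ᵥ P.mulVec β) =
          -(1 / 2) * ((β - βt) ⬝ᵥ Vinv.mulVec (β - βt)) + c := by
  intro A Λinv Vinv V βt c
  have hΛ : Λinv.IsSymm := isSymm_diagonal _
  have hV : Vinv.PosDef := by
    have hΛpos : Λinv.PosSemidef := PosSemidef.diagonal fun i => (inv_pos.2 (hlam i)).le
    refine PosDef.posSemidef_add ?_ hP
    simpa only [conjTranspose_eq_transpose_of_trivial] using
      hΛpos.conjTranspose_mul_mul_same A
  refine ⟨hV, fun β => ?_⟩
  have hVsymm : Vinv.IsSymm := by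
    simpa only [IsHermitian, IsSymm, conjTranspose_eq_transpose_of_trivial] using hV.isHermitian
  have hβt : Vinv.mulVec βt = (a - (a - b) / 2) • Xᵀ.mulVec y := by
    simp only [βt, V, mulVec_smul, mulVec_mulVec]
    rw [← Matrix.mul_assoc, mul_nonsing_inv _ ((isUnit_iff_isUnit_det _).1 hV.isUnit),
      Matrix.one_mul]
  have hlin : y ⬝ᵥ X.mulVec β = β ⬝ᵥ Xᵀ.mulVec y := by
    rw [dotProduct_mulVec, ← mulVec_transpose, dotProduct_comm]
  have hw : Aᵀ.mulVec (Λinv.mulVec lam) = Xᵀ.mulVec y :=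
    transpose_diagonal_mul_mulVec_inv_mulVec X y fun i => (hlam i).ne'
  have hsq := dotProduct_mulVec_complete_square hVsymm β βt
  have hquad : β ⬝ᵥ Vinv.mulVec β = β ⬝ᵥ (Aᵀ * Λinv * A).mulVec β + β ⬝ᵥ P.mulVec β := by
    simp only [Vinv, add_mulVec, dotProduct_add]
  have hcross : β ⬝ᵥ Vinv.mulVec βt = (a - (a - b) / 2) * (β ⬝ᵥ Xᵀ.mulVec y) := by
    rw [hβt, dotProduct_smul, smul_eq_mul]
  rw [hcross, hquad] at hsq
  rw [dotProduct_mulVec_mulVec_add_smul hΛ, hw, hlin]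
  simp only [c]
  linear_combination hsq
end
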